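/- Let f : ℝ → ℝ be a C³ function, bounded together with its first three derivatives, and let u : ℝ×ℝ → ℝ be a smooth classical solution of the mKdV equation u_t + (u_{xx} + u³)_x = 0 such that for each t, u(t,·) together with its x-derivatives up to order three is Schwartz (rapidly decaying). Then for all t, (d/dt)[(1/2)∫ u(t,x)² f(x) dx] = ∫ (−(3/2)·u_x² + (3/4)·u⁴)·f'(x) dx + (1/2)∫ u²·f'''(x) dx. -/

import Mathlib

open Real MeasureTheory

/-- If `ψ` and `φ` are integrable on the line and `ψ' + φ` has an integrable derivative, then
`ψ' + φ` tends to zero at `+∞`. -/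
theorem tendsto_deriv_add_atTop {ψ ψ' φ r : ℝ → ℝ} (hψ : Integrable ψ) (hφ : Integrable φ)
    (hφc : Continuous φ) (hψ' : ∀ x, HasDerivAt ψ (ψ' x) x)
    (hr : ∀ x, HasDerivAt (fun y => ψ' y + φ y) (r x) x) (hri : Integrable r) :
    Filter.Tendsto (fun x => ψ' x + φ x) Filter.atTop (nhds 0) := by
  have hlim := tendsto_limUnder_of_hasDerivAt_of_integrableOn_Ioi (a := 0)
    (fun x _ => hr x) hri.integrableOn
  set L := Filter.atTop.limUnder (fun x => ψ' x + φ x)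
  have hS : ∀ x, HasDerivAt (fun y => ψ y + ∫ z in (0 : ℝ)..y, φ z) (ψ' x + φ x) x := fun x =>
    (hψ' x).add (hφc.integral_hasStrictDerivAt 0 x).hasDerivAt
  have hmv : ∀ x : ℝ, ∃ c, x < c ∧
      ψ' c + φ c = (ψ (x + 1) + ∫ z in (0 : ℝ)..(x + 1), φ z) - (ψ x + ∫ z in (0 : ℝ)..x, φ z) := by
    intro x
    obtain ⟨c, hc, h⟩ := exists_hasDerivAt_eq_slope
      (fun y => ψ y + ∫ z in (0 : ℝ)..y, φ z) (fun x => ψ' x + φ x) (lt_add_one x)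
      (fun y _ => (hS y).continuousAt.continuousWithinAt) (fun y _ => hS y)
    exact ⟨c, hc.1, by rw [h]; simp⟩
  choose c hc hceq using hmv
  have hc' : Filter.Tendsto c Filter.atTop Filter.atTop :=
    Filter.tendsto_atTop_mono (fun x => (hc x).le) Filter.tendsto_id
  have h1 := hlim.comp hc'
  have h2 : Filter.Tendsto (fun x => ∫ z in (0 : ℝ)..x, φ z) Filter.atTop
      (nhds (∫ z in Set.Ioi (0 : ℝ), φ z)) :=
    intervalIntegral_tendsto_integral_Ioi 0 hφ.integrableOn Filter.tendsto_id
  have h3 : Filter.Tendsto (fun x => ∫ z in (0 : ℝ)..(x + 1), φ z) Filter.atTop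
      (nhds (∫ z in Set.Ioi (0 : ℝ), φ z)) :=
    h2.comp (Filter.tendsto_atTop_add_const_right _ 1 Filter.tendsto_id)
  have h4 : Filter.Tendsto (fun x => ψ (x + 1) - ψ x) Filter.atTop (nhds L) := by
    have := (h1.sub h3).add h2
    simp only [sub_add_cancel] at this
    refine this.congr fun x => ?_
    simp only [Function.comp_apply, hceq]
    ring
  have hL : L = 0 := by
    refine IntegrableAtFilter.eq_zero_of_tendsto
      (((hψ.comp_add_right 1).sub hψ).integrableAtFilter _) (fun s hs => ?_) h4
    obtain ⟨a, ha⟩ := Filter.mem_atTop_sets.1 hs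
    exact measure_mono_top (fun x hx => ha x hx) (Real.volume_Ici (a := a))
  rwa [hL] at hlim

/-- If `ψ` and `φ` are integrable on the line and `ψ' + φ` has an integrable derivative, then the
integral of this derivative vanishes. -/
theorem integral_eq_zero_of_hasDerivAt_deriv_add {ψ ψ' φ r : ℝ → ℝ} (hψ : Integrable ψ)
    (hφ : Integrable φ) (hφc : Continuous φ) (hψ' : ∀ x, HasDerivAt ψ (ψ' x) x)
    (hr : ∀ x, HasDerivAt (fun y => ψ' y + φ y) (r x) x) (hri : Integrable r) :
    ∫ x, r x = 0 := by
  have htop := tendsto_deriv_add_atTop hψ hφ hφc hψ' hr hri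
  have hbot' : Filter.Tendsto (fun x => -ψ' (-x) + -φ (-x)) Filter.atTop (nhds 0) := by
    refine tendsto_deriv_add_atTop (ψ := fun x => ψ (-x)) (r := fun x => r (-x))
      hψ.comp_neg hφ.comp_neg.neg (hφc.comp continuous_neg).neg (fun x => ?_) (fun x => ?_)
      hri.comp_neg
    · exact ((hψ' (-x)).comp x (hasDerivAt_neg x)).congr_deriv (by ring)
    · have := ((hr (-x)).comp x (hasDerivAt_neg x)).fun_neg.congr_deriv
        (by ring : -(r (-x) * -1) = r (-x))
      exact this.congr_of_eventuallyEq (Filter.Eventually.of_forall fun y => by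
        simp only [Function.comp_apply]; ring)
  have hbot : Filter.Tendsto (fun x => ψ' x + φ x) Filter.atBot (nhds 0) := by
    have := (hbot'.comp Filter.tendsto_neg_atBot_atTop).neg
    refine (this.congr fun x => ?_).trans (by simp)
    simp [add_comm]
  simpa using integral_of_hasDerivAt_of_tendsto hr hri hbot htop

/-- Differentiation under an interval integral of a jointly continuous integrand. -/
theorem hasDerivAt_intervalIntegral_of_continuous {F F' : ℝ → ℝ → ℝ} (s t : ℝ)
    (hF : Continuous (Function.uncurry F)) (hF' : Continuous (Function.uncurry F'))
    (h : ∀ τ x, HasDerivAt (F τ) (F' τ x) x) (x : ℝ) :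
    HasDerivAt (fun y => ∫ τ in s..t, F τ y) (∫ τ in s..t, F' τ x) x := by
  have hK : IsCompact (Set.uIcc s t ×ˢ Metric.closedBall x 1) :=
    isCompact_uIcc.prod (isCompact_closedBall x 1)
  obtain ⟨C, hC⟩ := hK.exists_bound_of_continuousOn hF'.continuousOn
  have hc : ∀ y, Continuous fun τ => F τ y := fun y => hF.comp (by fun_prop : Continuous fun τ => (τ, y))
  have hc' : ∀ y, Continuous fun τ => F' τ y := fun y => hF'.comp (by fun_prop : Continuous fun τ => (τ, y))
  refine (intervalIntegral.hasDerivAt_integral_of_dominated_loc_of_deriv_le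
    (F := fun y τ => F τ y) (F' := fun y τ => F' τ y) (bound := fun _ => C)
    (Metric.closedBall_mem_nhds x one_pos)
    (Filter.Eventually.of_forall fun y => (hc y).aestronglyMeasurable)
    ((hc x).intervalIntegrable _ _) (hc' x).aestronglyMeasurable
    (Filter.Eventually.of_forall fun τ hτ y hy => ?_) (by simp)
    (Filter.Eventually.of_forall fun τ _ y _ => h τ y)).2
  exact hC (τ, y) ⟨Set.uIoc_subset_uIcc hτ, hy⟩

/-- A jointly continuous function dominated on a time interval by a density with bounded mass is
integrable in space-time. -/
theorem integrable_prod_of_dominated {F ρ : ℝ → ℝ → ℝ} {s t B C : ℝ}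
    (hF : Continuous (Function.uncurry F))
    (hρi : ∀ τ ∈ Set.Icc s t, Integrable (ρ τ)) (hρB : ∀ τ ∈ Set.Icc s t, ∫ x, ρ τ x ≤ B)
    (hC : 0 ≤ C) (hFρ : ∀ τ ∈ Set.Icc s t, ∀ x, |F τ x| ≤ C * ρ τ x) :
    Integrable (Function.uncurry F) ((volume.restrict (Set.Ioc s t)).prod volume) := by
  have hFi : ∀ τ ∈ Set.Icc s t, Integrable (F τ) := fun τ hτ =>
    ((hρi τ hτ).const_mul C).mono'
      (hF.comp (by fun_prop : Continuous fun x => (τ, x))).aestronglyMeasurable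
      (Filter.Eventually.of_forall fun x => hFρ τ hτ x)
  rw [integrable_prod_iff hF.aestronglyMeasurable]
  refine ⟨(ae_restrict_iff' measurableSet_Ioc).2
    (Filter.Eventually.of_forall fun τ hτ => hFi τ (Set.Ioc_subset_Icc_self hτ)), ?_⟩
  refine Integrable.mono' (integrable_const (C * B))
    hF.aestronglyMeasurable.norm.integral_prod_right' ?_
  refine (ae_restrict_iff' measurableSet_Ioc).2 (Filter.Eventually.of_forall fun τ hτ => ?_)
  have hτ' := Set.Ioc_subset_Icc_self hτ
  rw [Real.norm_of_nonneg (integral_nonneg fun x => norm_nonneg _)]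
  calc ∫ x, ‖Function.uncurry F (τ, x)‖ ≤ ∫ x, C * ρ τ x :=
        integral_mono (hFi τ hτ').norm ((hρi τ hτ').const_mul C) (hFρ τ hτ')
    _ ≤ C * B := by
        rw [integral_const_mul]
        exact mul_le_mul_of_nonneg_left (hρB τ hτ') hC

/-- Integrated form of a local balance law `∂ₜ e + ∂ₓ J + ∂ₓ² A = g`, all of whose terms are
dominated by a density of bounded mass. -/
theorem integral_sub_integral_of_balance {e J J' A A' A'' g ρ : ℝ → ℝ → ℝ} {s t B C : ℝ}
    (hst : s ≤ t)
    (hρi : ∀ τ ∈ Set.Icc s t, Integrable (ρ τ)) (hρB : ∀ τ ∈ Set.Icc s t, ∫ x, ρ τ x ≤ B)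
    (hC : 0 ≤ C)
    (hec : Continuous (Function.uncurry e))
    (hJc : Continuous (Function.uncurry J)) (hJc' : Continuous (Function.uncurry J'))
    (hAc : Continuous (Function.uncurry A)) (hAc' : Continuous (Function.uncurry A'))
    (hAc'' : Continuous (Function.uncurry A'')) (hgc : Continuous (Function.uncurry g))
    (hJ : ∀ τ x, HasDerivAt (J τ) (J' τ x) x)
    (hA : ∀ τ x, HasDerivAt (A τ) (A' τ x) x) (hA' : ∀ τ x, HasDerivAt (A' τ) (A'' τ x) x)
    (he : ∀ τ x, HasDerivAt (fun σ => e σ x) (g τ x - J' τ x - A'' τ x) τ)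
    (heρ : ∀ τ ∈ Set.Icc s t, ∀ x, |e τ x| ≤ C * ρ τ x)
    (hJρ : ∀ τ ∈ Set.Icc s t, ∀ x, |J τ x| ≤ C * ρ τ x)
    (hAρ : ∀ τ ∈ Set.Icc s t, ∀ x, |A τ x| ≤ C * ρ τ x)
    (hgρ : ∀ τ ∈ Set.Icc s t, ∀ x, |g τ x| ≤ C * ρ τ x) :
    (∫ x, e t x) - ∫ x, e s x = ∫ τ in s..t, ∫ x, g τ x := by
  have hsl : ∀ {F : ℝ → ℝ → ℝ}, Continuous (Function.uncurry F) → ∀ τ, Continuous (F τ) :=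
    fun hF τ => hF.comp (by fun_prop : Continuous fun x => (τ, x))
  have hsl' : ∀ {F : ℝ → ℝ → ℝ}, Continuous (Function.uncurry F) → ∀ x, Continuous fun τ => F τ x :=
    fun hF x => hF.comp (by fun_prop : Continuous fun τ => (τ, x))
  have hei : ∀ τ ∈ Set.Icc s t, Integrable (e τ) := fun τ hτ =>
    ((hρi τ hτ).const_mul C).mono' (hsl hec τ).aestronglyMeasurable
      (Filter.Eventually.of_forall fun x => heρ τ hτ x)
  have hprod : ∀ {F : ℝ → ℝ → ℝ}, Continuous (Function.uncurry F) →
      (∀ τ ∈ Set.Icc s t, ∀ x, |F τ x| ≤ C * ρ τ x) →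
      Integrable (Function.uncurry F) ((volume.restrict (Set.Ioc s t)).prod volume) :=
    fun hF h => integrable_prod_of_dominated hF hρi hρB hC h
  have hint : ∀ {F : ℝ → ℝ → ℝ}, Continuous (Function.uncurry F) →
      (∀ τ ∈ Set.Icc s t, ∀ x, |F τ x| ≤ C * ρ τ x) →
      Integrable fun x => ∫ τ in s..t, F τ x := by
    intro F hF h
    simp only [intervalIntegral.integral_of_le hst]
    exact (hprod hF h).integral_prod_right
  have hr : ∀ x, (∫ τ in s..t, J' τ x) + ∫ τ in s..t, A'' τ x
      = (∫ τ in s..t, g τ x) - (e t x - e s x) := by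
    intro x
    rw [← intervalIntegral.integral_eq_sub_of_hasDerivAt (fun τ _ => he τ x)
      ((((hsl' hgc x).sub (hsl' hJc' x)).sub (hsl' hAc'' x)).intervalIntegrable _ _),
      intervalIntegral.integral_sub, intervalIntegral.integral_sub]
    · ring
    all_goals apply Continuous.intervalIntegrable
    exacts [hsl' hgc x, hsl' hJc' x, (hsl' hgc x).sub (hsl' hJc' x), hsl' hAc'' x]
  have hzero := integral_eq_zero_of_hasDerivAt_deriv_add
    (ψ := fun x => ∫ τ in s..t, A τ x) (ψ' := fun x => ∫ τ in s..t, A' τ x)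
    (φ := fun x => ∫ τ in s..t, J τ x)
    (r := fun x => (∫ τ in s..t, g τ x) - (e t x - e s x))
    (hint hAc hAρ) (hint hJc hJρ)
    (intervalIntegral.continuous_parametric_intervalIntegral_of_continuous'
      (f := fun x τ => J τ x) (hJc.comp continuous_swap) s t)
    (hasDerivAt_intervalIntegral_of_continuous s t hAc hAc' hA)
    (fun x => by
      rw [← hr, add_comm]
      exact (hasDerivAt_intervalIntegral_of_continuous s t hAc' hAc'' hA' x).add
        (hasDerivAt_intervalIntegral_of_continuous s t hJc hJc' hJ x))
    ((hint hgc hgρ).sub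
      ((hei t (Set.right_mem_Icc.2 hst)).sub (hei s (Set.left_mem_Icc.2 hst))))
  have hes : Integrable fun x => e t x - e s x :=
    (hei t (Set.right_mem_Icc.2 hst)).sub (hei s (Set.left_mem_Icc.2 hst))
  rw [integral_sub (hint hgc hgρ) hes, integral_sub (hei t (Set.right_mem_Icc.2 hst))
    (hei s (Set.left_mem_Icc.2 hst))] at hzero
  have hswap : ∫ τ in s..t, ∫ x, g τ x = ∫ x, ∫ τ in s..t, g τ x := by
    simp only [intervalIntegral.integral_of_le hst]
    exact integral_integral_swap (hprod hgc hgρ)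
  linarith

/-- `G` is bounded for times in `I`. -/
def BoundedOn (I : Set ℝ) (G : ℝ → ℝ → ℝ) : Prop :=
  ∃ M, ∀ τ ∈ I, ∀ x, |G τ x| ≤ M

/-- `F` is dominated by a multiple of the density `ρ` for times in `I`. -/
def DominatedOn (I : Set ℝ) (ρ F : ℝ → ℝ → ℝ) : Prop :=
  ∃ C, 0 ≤ C ∧ ∀ τ ∈ I, ∀ x, |F τ x| ≤ C * ρ τ x

/-- The square of `G` is dominated by a multiple of the density `ρ` for times in `I`. -/
def SqDominatedOn (I : Set ℝ) (ρ G : ℝ → ℝ → ℝ) : Prop :=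
  ∃ C, 0 ≤ C ∧ ∀ τ ∈ I, ∀ x, G τ x ^ 2 ≤ C * ρ τ x

section Domination

variable {I : Set ℝ} {ρ F G : ℝ → ℝ → ℝ}

theorem BoundedOn.const (c : ℝ) : BoundedOn I (fun _ _ => c) := ⟨|c|, fun _ _ _ => le_rfl⟩

theorem BoundedOn.add (hF : BoundedOn I F) (hG : BoundedOn I G) :
    BoundedOn I (fun τ x => F τ x + G τ x) := by
  obtain ⟨M, hM⟩ := hF
  obtain ⟨N, hN⟩ := hG
  exact ⟨M + N, fun τ hτ x => (abs_add_le _ _).trans (add_le_add (hM τ hτ x) (hN τ hτ x))⟩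

theorem BoundedOn.mul (hF : BoundedOn I F) (hG : BoundedOn I G) :
    BoundedOn I (fun τ x => F τ x * G τ x) := by
  obtain ⟨M, hM⟩ := hF
  obtain ⟨N, hN⟩ := hG
  refine ⟨M * N, fun τ hτ x => ?_⟩
  rw [abs_mul]
  exact mul_le_mul (hM τ hτ x) (hN τ hτ x) (abs_nonneg _) ((abs_nonneg _).trans (hM τ hτ x))

theorem BoundedOn.pow (hF : BoundedOn I F) (n : ℕ) : BoundedOn I (fun τ x => F τ x ^ n) := by
  obtain ⟨M, hM⟩ := hF
  refine ⟨M ^ n, fun τ hτ x => ?_⟩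
  rw [abs_pow]
  exact pow_le_pow_left₀ (abs_nonneg _) (hM τ hτ x) n

theorem SqDominatedOn.add (hF : SqDominatedOn I ρ F) (hG : SqDominatedOn I ρ G) :
    SqDominatedOn I ρ (fun τ x => F τ x + G τ x) := by
  obtain ⟨C, hC, hF⟩ := hF
  obtain ⟨D, hD, hG⟩ := hG
  refine ⟨2 * C + 2 * D, by positivity, fun τ hτ x => ?_⟩
  nlinarith [hF τ hτ x, hG τ hτ x, sq_nonneg (F τ x - G τ x)]

theorem SqDominatedOn.mono {ρ' : ℝ → ℝ → ℝ} (hF : SqDominatedOn I ρ F)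
    (hρ : ∀ τ ∈ I, ∀ x, ρ τ x ≤ ρ' τ x) : SqDominatedOn I ρ' F := by
  obtain ⟨C, hC, hF⟩ := hF
  exact ⟨C, hC, fun τ hτ x => (hF τ hτ x).trans (mul_le_mul_of_nonneg_left (hρ τ hτ x) hC)⟩

theorem SqDominatedOn.sub (hF : SqDominatedOn I ρ F) (hG : SqDominatedOn I ρ G) :
    SqDominatedOn I ρ (fun τ x => F τ x - G τ x) := by
  obtain ⟨C, hC, hF⟩ := hF
  obtain ⟨D, hD, hG⟩ := hG
  refine ⟨2 * C + 2 * D, by positivity, fun τ hτ x => ?_⟩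
  nlinarith [hF τ hτ x, hG τ hτ x, sq_nonneg (F τ x + G τ x)]

theorem BoundedOn.mul_sqDominatedOn (hF : BoundedOn I F) (hG : SqDominatedOn I ρ G) :
    SqDominatedOn I ρ (fun τ x => F τ x * G τ x) := by
  obtain ⟨M, hM⟩ := hF
  obtain ⟨C, hC, hG⟩ := hG
  refine ⟨M ^ 2 * C, by positivity, fun τ hτ x => ?_⟩
  rw [mul_pow, mul_assoc]
  have h : F τ x ^ 2 ≤ M ^ 2 := by
    rw [← sq_abs]
    exact pow_le_pow_left₀ (abs_nonneg _) (hM τ hτ x) 2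
  exact mul_le_mul h (hG τ hτ x) (sq_nonneg _) (sq_nonneg _)

theorem SqDominatedOn.mul (hF : SqDominatedOn I ρ F) (hG : SqDominatedOn I ρ G) :
    DominatedOn I ρ (fun τ x => F τ x * G τ x) := by
  obtain ⟨C, hC, hF⟩ := hF
  obtain ⟨D, hD, hG⟩ := hG
  refine ⟨C + D, by positivity, fun τ hτ x => ?_⟩
  have h1 := hF τ hτ x
  have h2 := hG τ hτ x
  rw [abs_le]
  constructor <;> nlinarith [sq_nonneg (F τ x - G τ x), sq_nonneg (F τ x + G τ x),
    sq_nonneg (F τ x), sq_nonneg (G τ x)]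

theorem DominatedOn.add (hF : DominatedOn I ρ F) (hG : DominatedOn I ρ G) :
    DominatedOn I ρ (fun τ x => F τ x + G τ x) := by
  obtain ⟨C, hC, hF⟩ := hF
  obtain ⟨D, hD, hG⟩ := hG
  refine ⟨C + D, by positivity, fun τ hτ x => (abs_add_le _ _).trans ?_⟩
  rw [add_mul]
  exact add_le_add (hF τ hτ x) (hG τ hτ x)

theorem BoundedOn.mul_dominatedOn (hF : BoundedOn I F) (hG : DominatedOn I ρ G) :
    DominatedOn I ρ (fun τ x => F τ x * G τ x) := by
  obtain ⟨M, hM⟩ := hF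
  obtain ⟨C, hC, hG⟩ := hG
  refine ⟨|M| * C, by positivity, fun τ hτ x => ?_⟩
  rw [abs_mul, mul_assoc]
  exact mul_le_mul ((hM τ hτ x).trans (le_abs_self M)) (hG τ hτ x) (abs_nonneg _) (abs_nonneg _)

theorem DominatedOn.zero : DominatedOn I ρ (fun _ _ => 0) :=
  ⟨0, le_rfl, fun _ _ _ => by simp⟩

theorem DominatedOn.mono {J : Set ℝ} (hF : DominatedOn I ρ F) (hJ : J ⊆ I) :
    DominatedOn J ρ F := by
  obtain ⟨C, hC, hF⟩ := hF
  exact ⟨C, hC, fun τ hτ => hF τ (hJ hτ)⟩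

theorem DominatedOn.integrable (hF : DominatedOn I ρ F) (hFc : Continuous (Function.uncurry F))
    {τ : ℝ} (hτ : τ ∈ I) (hρ : Integrable (ρ τ)) : Integrable (F τ) := by
  obtain ⟨C, -, hF⟩ := hF
  exact (hρ.const_mul C).mono'
    (hFc.comp (by fun_prop : Continuous fun x => (τ, x))).aestronglyMeasurable
    (Filter.Eventually.of_forall fun x => hF τ hτ x)

end Domination

/-- Integrated form of a local balance law `∂ₜ e + ∂ₓ J + ∂ₓ² A = g`, all of whose terms are
dominated by a density of bounded mass. -/
theorem integral_sub_integral_of_dominatedOn {e J J' A A' A'' g ρ : ℝ → ℝ → ℝ} {s t B : ℝ}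
    (hst : s ≤ t) (hρ : ∀ τ x, 0 ≤ ρ τ x)
    (hρi : ∀ τ ∈ Set.Icc s t, Integrable (ρ τ)) (hρB : ∀ τ ∈ Set.Icc s t, ∫ x, ρ τ x ≤ B)
    (hec : Continuous (Function.uncurry e))
    (hJc : Continuous (Function.uncurry J)) (hJc' : Continuous (Function.uncurry J'))
    (hAc : Continuous (Function.uncurry A)) (hAc' : Continuous (Function.uncurry A'))
    (hAc'' : Continuous (Function.uncurry A'')) (hgc : Continuous (Function.uncurry g))
    (hJ : ∀ τ x, HasDerivAt (J τ) (J' τ x) x)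
    (hA : ∀ τ x, HasDerivAt (A τ) (A' τ x) x) (hA' : ∀ τ x, HasDerivAt (A' τ) (A'' τ x) x)
    (he : ∀ τ x, HasDerivAt (fun σ => e σ x) (g τ x - J' τ x - A'' τ x) τ)
    (heρ : DominatedOn (Set.Icc s t) ρ e) (hJρ : DominatedOn (Set.Icc s t) ρ J)
    (hAρ : DominatedOn (Set.Icc s t) ρ A) (hgρ : DominatedOn (Set.Icc s t) ρ g) :
    (∫ x, e t x) - ∫ x, e s x = ∫ τ in s..t, ∫ x, g τ x := by
  obtain ⟨C₁, hC₁, h₁⟩ := heρ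
  obtain ⟨C₂, hC₂, h₂⟩ := hJρ
  obtain ⟨C₃, hC₃, h₃⟩ := hAρ
  obtain ⟨C₄, hC₄, h₄⟩ := hgρ
  have aux : ∀ {F : ℝ → ℝ → ℝ} {C : ℝ}, C ≤ C₁ + C₂ + C₃ + C₄ →
      (∀ τ ∈ Set.Icc s t, ∀ x, |F τ x| ≤ C * ρ τ x) →
      ∀ τ ∈ Set.Icc s t, ∀ x, |F τ x| ≤ (C₁ + C₂ + C₃ + C₄) * ρ τ x := fun hC h τ hτ x =>
    (h τ hτ x).trans (mul_le_mul_of_nonneg_right hC (hρ τ x))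
  exact integral_sub_integral_of_balance hst hρi hρB (by positivity) hec hJc hJc' hAc hAc' hAc'' hgc
    hJ hA hA' he (aux (by linarith) h₁) (aux (by linarith) h₂) (aux (by linarith) h₃)
    (aux (by linarith) h₄)

/-- The time integral of the mass of a dominated density is bounded by any bound on this mass. -/
theorem intervalIntegral_integral_le_of_dominatedOn {g ρ : ℝ → ℝ → ℝ} {s t B H : ℝ} (hst : s ≤ t)
    (hρi : ∀ τ ∈ Set.Icc s t, Integrable (ρ τ)) (hρB : ∀ τ ∈ Set.Icc s t, ∫ x, ρ τ x ≤ B)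
    (hgc : Continuous (Function.uncurry g)) (hgρ : DominatedOn (Set.Icc s t) ρ g)
    (hH : ∀ τ ∈ Set.Icc s t, ∫ x, g τ x ≤ H) :
    ∫ τ in s..t, ∫ x, g τ x ≤ H * (t - s) := by
  obtain ⟨C, hC, h⟩ := hgρ
  have hi := (integrable_prod_of_dominated hgc hρi hρB hC h).integral_prod_left
  have : ∫ τ in s..t, ∫ x, g τ x ≤ ∫ _ in s..t, H := by
    refine intervalIntegral.integral_mono_on hst ?_ (by simp) hH
    rw [intervalIntegrable_iff_integrableOn_Ioc_of_le hst]
    exact hi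
  simpa [mul_comm] using this

/-- The `k`-th space derivative of a function of time and space. -/
noncomputable def xDeriv (u : ℝ → ℝ → ℝ) (k : ℕ) (t x : ℝ) : ℝ := iteratedDeriv k (u t) x

/-- The third order Sobolev energy density of a function of time and space. -/
noncomputable def sobolevDensity (u : ℝ → ℝ → ℝ) (t x : ℝ) : ℝ :=
  xDeriv u 0 t x ^ 2 + xDeriv u 1 t x ^ 2 + xDeriv u 2 t x ^ 2 + xDeriv u 3 t x ^ 2

/-- The squared third order Sobolev norm at time `t`. -/
noncomputable def sobolevSq (u : ℝ → ℝ → ℝ) (t : ℝ) : ℝ := ∫ x, sobolevDensity u t x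

theorem hasDerivAt_fderiv_right {F : ℝ → ℝ → ℝ} (hF : Differentiable ℝ (Function.uncurry F))
    (t x : ℝ) : HasDerivAt (F t) (fderiv ℝ (Function.uncurry F) (t, x) (0, 1)) x := by
  have h : HasDerivAt (fun y : ℝ => (t, y)) ((0 : ℝ), (1 : ℝ)) x :=
    (hasDerivAt_const x t).prodMk (hasDerivAt_id x)
  exact (hF (t, x)).hasFDerivAt.comp_hasDerivAt x h

theorem hasDerivAt_fderiv_left {F : ℝ → ℝ → ℝ} (hF : Differentiable ℝ (Function.uncurry F))
    (t x : ℝ) : HasDerivAt (fun s => F s x) (fderiv ℝ (Function.uncurry F) (t, x) (1, 0)) t := by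
  have h : HasDerivAt (fun s : ℝ => (s, x)) ((1 : ℝ), (0 : ℝ)) t :=
    (hasDerivAt_id t).prodMk (hasDerivAt_const t x)
  exact (hF (t, x)).hasFDerivAt.comp_hasDerivAt t h

theorem contDiff_xDeriv {u : ℝ → ℝ → ℝ} (hu : ContDiff ℝ (⊤ : ℕ∞) (Function.uncurry u)) (k : ℕ) :
    ContDiff ℝ (⊤ : ℕ∞) (Function.uncurry (xDeriv u k)) := by
  induction k with
  | zero =>
    have : xDeriv u 0 = u := by ext; simp [xDeriv]
    rwa [this]
  | succ k ih =>
    have : Function.uncurry (xDeriv u (k + 1))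
        = fun p => fderiv ℝ (Function.uncurry (xDeriv u k)) p (0, 1) := by
      ext ⟨t, x⟩
      have := (hasDerivAt_fderiv_right (ih.differentiable (by simp)) t x).deriv
      rw [← this]
      simp only [Function.uncurry_apply_pair, xDeriv, iteratedDeriv_succ]
      rfl
    rw [this]
    exact (ih.fderiv_right (m := (⊤ : ℕ∞)) (by simp)).clm_apply contDiff_const

theorem hasDerivAt_xDeriv {u : ℝ → ℝ → ℝ} (hu : ContDiff ℝ (⊤ : ℕ∞) (Function.uncurry u)) (k : ℕ)
    (t x : ℝ) : HasDerivAt (xDeriv u k t) (xDeriv u (k + 1) t x) x := by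
  have h := hasDerivAt_fderiv_right ((contDiff_xDeriv hu k).differentiable (by simp)) t x
  have : xDeriv u (k + 1) t x = deriv (xDeriv u k t) x := by
    simp only [xDeriv, iteratedDeriv_succ]
    rfl
  rw [this, h.deriv]
  exact h

theorem continuous_xDeriv {u : ℝ → ℝ → ℝ} (hu : ContDiff ℝ (⊤ : ℕ∞) (Function.uncurry u)) (k : ℕ) :
    Continuous fun p : ℝ × ℝ => xDeriv u k p.1 p.2 :=
  (contDiff_xDeriv hu k).continuous

/-- Time and space derivatives of a smooth function commute. -/
theorem hasDerivAt_left_of_hasDerivAt_right {F F' G G' : ℝ → ℝ → ℝ}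
    (hF : ContDiff ℝ (⊤ : ℕ∞) (Function.uncurry F))
    (hF' : ∀ t x, HasDerivAt (F t) (F' t x) x)
    (hG : ∀ t x, HasDerivAt (fun s => F s x) (G t x) t)
    (hG' : ∀ t x, HasDerivAt (G t) (G' t x) x) (t x : ℝ) :
    HasDerivAt (fun s => F' s x) (G' t x) t := by
  have hd := hF.differentiable (by simp)
  have hF'eq : ∀ t x, F' t x = fderiv ℝ (Function.uncurry F) (t, x) (0, 1) := fun t x =>
    (hF' t x).unique (hasDerivAt_fderiv_right hd t x)
  have hGeq : ∀ t x, G t x = fderiv ℝ (Function.uncurry F) (t, x) (1, 0) := fun t x =>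
    (hG t x).unique (hasDerivAt_fderiv_left hd t x)
  have hD : ContDiff ℝ (⊤ : ℕ∞) (fderiv ℝ (Function.uncurry F)) :=
    hF.fderiv_right (m := (⊤ : ℕ∞)) (by simp)
  have hDD : ∀ p, HasFDerivAt (fderiv ℝ (Function.uncurry F))
      (fderiv ℝ (fderiv ℝ (Function.uncurry F)) p) p := fun p =>
    (hD.differentiable (by simp) p).hasFDerivAt
  have h1 : HasDerivAt (fun s : ℝ => (s, x)) ((1 : ℝ), (0 : ℝ)) t :=
    (hasDerivAt_id t).prodMk (hasDerivAt_const t x)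
  have h2 : HasDerivAt (fun y : ℝ => (t, y)) ((0 : ℝ), (1 : ℝ)) x :=
    (hasDerivAt_const x t).prodMk (hasDerivAt_id x)
  have h3 : HasDerivAt (fun s => F' s x)
      (fderiv ℝ (fderiv ℝ (Function.uncurry F)) (t, x) (1, 0) (0, 1)) t := by
    simp only [hF'eq]
    exact (ContinuousLinearMap.apply ℝ ℝ ((0 : ℝ), (1 : ℝ))).hasFDerivAt.comp_hasDerivAt t
      ((hDD (t, x)).comp_hasDerivAt t h1)
  have h4 : HasDerivAt (G t)
      (fderiv ℝ (fderiv ℝ (Function.uncurry F)) (t, x) (0, 1) (1, 0)) x := by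
    have : G t = fun y => fderiv ℝ (Function.uncurry F) (t, y) (1, 0) := funext fun y => hGeq t y
    rw [this]
    exact (ContinuousLinearMap.apply ℝ ℝ ((1 : ℝ), (0 : ℝ))).hasFDerivAt.comp_hasDerivAt x
      ((hDD (t, x)).comp_hasDerivAt x h2)
  have hsymm : IsSymmSndFDerivAt ℝ (Function.uncurry F) (t, x) :=
    (hF.of_le (m := 2) (WithTop.coe_le_coe.2 le_top)).contDiffAt.isSymmSndFDerivAt (by simp)
  rw [(hG' t x).unique h4, hsymm.eq]
  exact h3

/-- A one-dimensional Sobolev inequality with a free parameter. -/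
theorem sq_le_integral_sq_deriv_add {v v' : ℝ → ℝ} (hv : ∀ x, HasDerivAt v (v' x) x)
    (hvc : Continuous v') (hi : Integrable fun x => v x ^ 2) (hi' : Integrable fun x => v' x ^ 2)
    {ε : ℝ} (hε : 0 < ε) (x : ℝ) : v x ^ 2 ≤ ε * (∫ y, v' y ^ 2) + ε⁻¹ * ∫ y, v y ^ 2 := by
  have hvc0 : Continuous v := continuous_iff_continuousAt.2 fun x => (hv x).continuousAt
  have hle : ∀ y, |2 * v y * v' y| ≤ ε * v' y ^ 2 + ε⁻¹ * v y ^ 2 := by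
    intro y
    have h : ε * v' y ^ 2 + ε⁻¹ * v y ^ 2 = ε⁻¹ * ((ε * v' y) ^ 2 + v y ^ 2) := by
      field_simp
    have h' : 2 * v y * v' y = ε⁻¹ * (2 * v y * (ε * v' y)) := by field_simp
    rw [h, h', abs_mul, abs_of_pos (inv_pos.2 hε)]
    refine mul_le_mul_of_nonneg_left ?_ (inv_pos.2 hε).le
    rw [abs_le]
    constructor <;> nlinarith [sq_nonneg (v y - ε * v' y), sq_nonneg (v y + ε * v' y)]
  have hsum : Integrable fun y => ε * v' y ^ 2 + ε⁻¹ * v y ^ 2 :=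
    (hi'.const_mul ε).add (hi.const_mul ε⁻¹)
  have hd : ∀ y, HasDerivAt (fun y => v y ^ 2) (2 * v y * v' y) y := fun y =>
    ((hv y).fun_pow 2).congr_deriv (by simp)
  have hdi : Integrable fun y => 2 * v y * v' y :=
    hsum.mono' (by fun_prop) (Filter.Eventually.of_forall hle)
  have htend : Filter.Tendsto (fun y => v y ^ 2) Filter.atBot (nhds 0) :=
    tendsto_zero_of_hasDerivAt_of_integrableOn_Iic (a := 0) (fun y _ => hd y) hdi.integrableOn
      hi.integrableOn
  have hint := integral_Iic_of_hasDerivAt_of_tendsto (a := x) (hd x).continuousAt.continuousWithinAt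
    (fun y _ => hd y) hdi.integrableOn htend
  calc v x ^ 2 = ∫ y in Set.Iic x, 2 * v y * v' y := by rw [hint]; ring
    _ ≤ ∫ y in Set.Iic x, (ε * v' y ^ 2 + ε⁻¹ * v y ^ 2) :=
        setIntegral_mono hdi.integrableOn hsum.integrableOn fun y => (le_abs_self _).trans (hle y)
    _ ≤ ∫ y, (ε * v' y ^ 2 + ε⁻¹ * v y ^ 2) :=
        setIntegral_le_integral hsum (Filter.Eventually.of_forall fun y => by positivity)
    _ = _ := by rw [integral_add (hi'.const_mul ε) (hi.const_mul ε⁻¹), integral_const_mul,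
        integral_const_mul]

/-- `u` is a smooth solution of the forced mKdV equation `u_t + (u_xx + u³)_x = h` whose space
derivatives up to order three decay at every time. -/
structure IsForcedSolution (u h : ℝ → ℝ → ℝ) : Prop where
  smooth : ContDiff ℝ (⊤ : ℕ∞) (Function.uncurry u)
  time : ∀ t x, HasDerivAt (fun s => xDeriv u 0 s x)
    (h t x - (xDeriv u 3 t x + 3 * xDeriv u 0 t x ^ 2 * xDeriv u 1 t x)) t
  decay : ∀ t k, k ≤ 3 → ∃ C, ∀ x, (1 + x ^ 2) * |xDeriv u k t x| ≤ C

/-- The forcing-free case of `IsForcedSolution`. -/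
def IsSolution (u : ℝ → ℝ → ℝ) : Prop := IsForcedSolution u fun _ _ => 0

theorem sobolevDensity_nonneg (u : ℝ → ℝ → ℝ) (t x : ℝ) : 0 ≤ sobolevDensity u t x := by
  unfold sobolevDensity
  positivity

theorem continuous_sobolevDensity {u : ℝ → ℝ → ℝ}
    (hu : ContDiff ℝ (⊤ : ℕ∞) (Function.uncurry u)) :
    Continuous (Function.uncurry (sobolevDensity u)) := by
  have h := continuous_xDeriv hu
  have h0 := h 0
  have h1 := h 1
  have h2 := h 2
  have h3 := h 3
  show Continuous fun p : ℝ × ℝ => sobolevDensity u p.1 p.2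
  unfold sobolevDensity
  fun_prop

theorem sqDominatedOn_xDeriv (u : ℝ → ℝ → ℝ) (I : Set ℝ) {k : ℕ} (hk : k ≤ 3) :
    SqDominatedOn I (sobolevDensity u) (xDeriv u k) := by
  refine ⟨1, zero_le_one, fun τ _ x => ?_⟩
  unfold sobolevDensity
  interval_cases k <;> nlinarith [sq_nonneg (xDeriv u 0 τ x), sq_nonneg (xDeriv u 1 τ x),
    sq_nonneg (xDeriv u 2 τ x), sq_nonneg (xDeriv u 3 τ x)]

namespace IsForcedSolution

variable {u h : ℝ → ℝ → ℝ}

theorem integrable_xDeriv_sq (hu : IsForcedSolution u h) (t : ℝ) {k : ℕ} (hk : k ≤ 3) :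
    Integrable fun x => xDeriv u k t x ^ 2 := by
  obtain ⟨C, hC⟩ := hu.decay t k hk
  have hc : Continuous fun x => xDeriv u k t x :=
    (continuous_xDeriv hu.smooth k).comp (by fun_prop : Continuous fun x : ℝ => (t, x))
  refine (integrable_inv_one_add_sq.const_mul (C ^ 2)).mono' (by fun_prop)
    (Filter.Eventually.of_forall fun x => ?_)
  have hx : (1 : ℝ) ≤ 1 + x ^ 2 := by nlinarith [sq_nonneg x]
  have h1 : ((1 + x ^ 2) * |xDeriv u k t x|) ^ 2 ≤ C ^ 2 :=
    pow_le_pow_left₀ (by positivity) (hC x) 2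
  rw [mul_pow, sq_abs] at h1
  rw [Real.norm_of_nonneg (sq_nonneg _), ← div_eq_mul_inv, le_div_iff₀ (by positivity)]
  nlinarith [sq_nonneg (xDeriv u k t x), mul_nonneg (sq_nonneg (xDeriv u k t x))
    (mul_nonneg (sub_nonneg.2 hx) (zero_le_one.trans hx))]

theorem integrable_sobolevDensity (hu : IsForcedSolution u h) (t : ℝ) :
    Integrable (sobolevDensity u t) :=
  (((hu.integrable_xDeriv_sq t (by norm_num)).add (hu.integrable_xDeriv_sq t (by norm_num))).add
    (hu.integrable_xDeriv_sq t (by norm_num))).add (hu.integrable_xDeriv_sq t (by norm_num))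

theorem sobolevSq_eq (hu : IsForcedSolution u h) (t : ℝ) :
    sobolevSq u t = (∫ x, xDeriv u 0 t x ^ 2) + (∫ x, xDeriv u 1 t x ^ 2)
      + (∫ x, xDeriv u 2 t x ^ 2) + ∫ x, xDeriv u 3 t x ^ 2 := by
  have hi : ∀ k, k ≤ 3 → Integrable fun x => xDeriv u k t x ^ 2 := fun k hk =>
    hu.integrable_xDeriv_sq t hk
  have h01 : Integrable fun x => xDeriv u 0 t x ^ 2 + xDeriv u 1 t x ^ 2 :=
    (hi 0 (by norm_num)).add (hi 1 (by norm_num))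
  have h012 : Integrable fun x => xDeriv u 0 t x ^ 2 + xDeriv u 1 t x ^ 2 + xDeriv u 2 t x ^ 2 :=
    h01.add (hi 2 (by norm_num))
  unfold sobolevSq sobolevDensity
  rw [integral_add h012 (hi 3 le_rfl), integral_add h01 (hi 2 (by norm_num)),
    integral_add (hi 0 (by norm_num)) (hi 1 (by norm_num))]

theorem integral_xDeriv_sq_le (hu : IsForcedSolution u h) (t : ℝ) {k : ℕ} (hk : k ≤ 3) :
    ∫ x, xDeriv u k t x ^ 2 ≤ sobolevSq u t := by
  have hn : ∀ j, 0 ≤ ∫ x, xDeriv u j t x ^ 2 := fun j => integral_nonneg fun x => sq_nonneg _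
  rw [hu.sobolevSq_eq]
  interval_cases k <;> linarith [hn 0, hn 1, hn 2, hn 3]

theorem xDeriv_sq_le (hu : IsForcedSolution u h) (t x : ℝ) {k : ℕ} (hk : k ≤ 2) {ε : ℝ}
    (hε : 0 < ε) : xDeriv u k t x ^ 2 ≤
      ε * (∫ y, xDeriv u (k + 1) t y ^ 2) + ε⁻¹ * ∫ y, xDeriv u k t y ^ 2 :=
  sq_le_integral_sq_deriv_add (hasDerivAt_xDeriv hu.smooth k t)
    ((continuous_xDeriv hu.smooth (k + 1)).comp (by fun_prop : Continuous fun x : ℝ => (t, x)))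
    (hu.integrable_xDeriv_sq t (by omega)) (hu.integrable_xDeriv_sq t (by omega)) hε x

theorem boundedOn_xDeriv (hu : IsForcedSolution u h) {I : Set ℝ} {B : ℝ}
    (hB : ∀ τ ∈ I, sobolevSq u τ ≤ B) {k : ℕ} (hk : k ≤ 2) : BoundedOn I (xDeriv u k) := by
  refine ⟨√(2 * B), fun τ hτ x => Real.abs_le_sqrt ?_⟩
  have h1 := hu.xDeriv_sq_le τ x hk one_pos
  have h2 := hu.integral_xDeriv_sq_le τ (k := k) (by omega)
  have h3 := hu.integral_xDeriv_sq_le τ (k := k + 1) (by omega)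
  rw [inv_one] at h1
  linarith [hB τ hτ]

end IsForcedSolution

namespace IsSolution

variable {u : ℝ → ℝ → ℝ}

theorem hasDerivAt_time_zero (hu : IsSolution u) (t x : ℝ) :
    HasDerivAt (fun s => xDeriv u 0 s x)
      (-(xDeriv u 3 t x + 3 * xDeriv u 0 t x ^ 2 * xDeriv u 1 t x)) t :=
  (hu.time t x).congr_deriv (zero_sub _)

theorem hasDerivAt_time_one (hu : IsSolution u) (t x : ℝ) :
    HasDerivAt (fun s => xDeriv u 1 s x)
      (-(xDeriv u 4 t x + 6 * xDeriv u 0 t x * xDeriv u 1 t x ^ 2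
        + 3 * xDeriv u 0 t x ^ 2 * xDeriv u 2 t x)) t := by
  have hd := hasDerivAt_xDeriv hu.smooth
  refine hasDerivAt_left_of_hasDerivAt_right (contDiff_xDeriv hu.smooth 0) (hd 0)
    hu.hasDerivAt_time_zero (G' := fun t x => -(xDeriv u 4 t x
      + 6 * xDeriv u 0 t x * xDeriv u 1 t x ^ 2 + 3 * xDeriv u 0 t x ^ 2 * xDeriv u 2 t x))
    (fun t x => ?_) t x
  exact ((hd 3 t x).fun_add
    ((((hd 0 t x).fun_pow 2).const_mul 3).fun_mul (hd 1 t x))).fun_neg.congr_deriv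
    (by push_cast; ring)

theorem hasDerivAt_time_two (hu : IsSolution u) (t x : ℝ) :
    HasDerivAt (fun s => xDeriv u 2 s x)
      (-(xDeriv u 5 t x + 6 * xDeriv u 1 t x ^ 3
        + 18 * xDeriv u 0 t x * xDeriv u 1 t x * xDeriv u 2 t x
        + 3 * xDeriv u 0 t x ^ 2 * xDeriv u 3 t x)) t := by
  have hd := hasDerivAt_xDeriv hu.smooth
  refine hasDerivAt_left_of_hasDerivAt_right (contDiff_xDeriv hu.smooth 1) (hd 1)
    hu.hasDerivAt_time_one (G' := fun t x => -(xDeriv u 5 t x + 6 * xDeriv u 1 t x ^ 3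
        + 18 * xDeriv u 0 t x * xDeriv u 1 t x * xDeriv u 2 t x
        + 3 * xDeriv u 0 t x ^ 2 * xDeriv u 3 t x))
    (fun t x => ?_) t x
  exact (((hd 4 t x).fun_add
    (((hd 0 t x).const_mul 6).fun_mul ((hd 1 t x).fun_pow 2))).fun_add
    ((((hd 0 t x).fun_pow 2).const_mul 3).fun_mul (hd 2 t x))).fun_neg.congr_deriv
    (by push_cast; ring)

end IsSolution

namespace IsSolution

variable {u : ℝ → ℝ → ℝ}

theorem integral_balance (hu : IsSolution u) {s t B : ℝ} (hst : s ≤ t)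
    (hB : ∀ τ ∈ Set.Icc s t, sobolevSq u τ ≤ B) {e J J' A A' A'' g : ℝ → ℝ → ℝ}
    (hec : Continuous fun p : ℝ × ℝ => e p.1 p.2)
    (hJc : Continuous fun p : ℝ × ℝ => J p.1 p.2) (hJc' : Continuous fun p : ℝ × ℝ => J' p.1 p.2)
    (hAc : Continuous fun p : ℝ × ℝ => A p.1 p.2) (hAc' : Continuous fun p : ℝ × ℝ => A' p.1 p.2)
    (hAc'' : Continuous fun p : ℝ × ℝ => A'' p.1 p.2)
    (hgc : Continuous fun p : ℝ × ℝ => g p.1 p.2)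
    (hJ : ∀ τ x, HasDerivAt (J τ) (J' τ x) x)
    (hA : ∀ τ x, HasDerivAt (A τ) (A' τ x) x) (hA' : ∀ τ x, HasDerivAt (A' τ) (A'' τ x) x)
    (he : ∀ τ x, HasDerivAt (fun σ => e σ x) (g τ x - J' τ x - A'' τ x) τ)
    (heρ : DominatedOn (Set.Icc s t) (sobolevDensity u) e)
    (hJρ : DominatedOn (Set.Icc s t) (sobolevDensity u) J)
    (hAρ : DominatedOn (Set.Icc s t) (sobolevDensity u) A)
    (hgρ : DominatedOn (Set.Icc s t) (sobolevDensity u) g) :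
    (∫ x, e t x) - ∫ x, e s x = ∫ τ in s..t, ∫ x, g τ x :=
  integral_sub_integral_of_dominatedOn hst (sobolevDensity_nonneg u)
    (fun τ _ => hu.integrable_sobolevDensity τ) hB hec hJc hJc' hAc hAc' hAc'' hgc hJ hA hA' he
    heρ hJρ hAρ hgρ

/-- Conservation of mass. -/
theorem mass_eq (hu : IsSolution u) {s t B : ℝ} (hst : s ≤ t)
    (hB : ∀ τ ∈ Set.Icc s t, sobolevSq u τ ≤ B) :
    ∫ x, xDeriv u 0 t x ^ 2 = ∫ x, xDeriv u 0 s x ^ 2 := by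
  have hd := hasDerivAt_xDeriv hu.smooth
  have hc0 := continuous_xDeriv hu.smooth 0
  have hc1 := continuous_xDeriv hu.smooth 1
  have hc2 := continuous_xDeriv hu.smooth 2
  have hc3 := continuous_xDeriv hu.smooth 3
  have b0 := hu.boundedOn_xDeriv hB (k := 0) (by norm_num)
  have q0 := sqDominatedOn_xDeriv u (Set.Icc s t) (k := 0) (by norm_num)
  have q1 := sqDominatedOn_xDeriv u (Set.Icc s t) (k := 1) (by norm_num)
  have q2 := sqDominatedOn_xDeriv u (Set.Icc s t) (k := 2) (by norm_num)
  have key := hu.integral_balance hst hB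
    (e := fun τ x => xDeriv u 0 τ x * xDeriv u 0 τ x)
    (J := fun τ x => 2 * (xDeriv u 0 τ x * xDeriv u 2 τ x) + (-1) * (xDeriv u 1 τ x * xDeriv u 1 τ x)
      + 3 / 2 * xDeriv u 0 τ x ^ 2 * (xDeriv u 0 τ x * xDeriv u 0 τ x))
    (J' := fun τ x => 2 * xDeriv u 0 τ x * xDeriv u 3 τ x
      + 6 * xDeriv u 0 τ x ^ 3 * xDeriv u 1 τ x)
    (A := fun _ _ => 0) (A' := fun _ _ => 0) (A'' := fun _ _ => 0) (g := fun _ _ => 0)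
    (by fun_prop) (by fun_prop) (by fun_prop) (by fun_prop) (by fun_prop) (by fun_prop)
    (by fun_prop)
    (fun τ x => (((((hd 0 τ x).fun_mul (hd 2 τ x)).const_mul 2).fun_add
      (((hd 1 τ x).fun_mul (hd 1 τ x)).const_mul (-1))).fun_add
      ((((hd 0 τ x).fun_pow 2).const_mul (3 / 2)).fun_mul
        ((hd 0 τ x).fun_mul (hd 0 τ x)))).congr_deriv (by push_cast; ring))
    (fun _ _ => hasDerivAt_const _ _) (fun _ _ => hasDerivAt_const _ _)
    (fun τ x => ((hu.hasDerivAt_time_zero τ x).fun_mul (hu.hasDerivAt_time_zero τ x)).congr_deriv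
      (by ring))
    (q0.mul q0)
    ((((BoundedOn.const _).mul_dominatedOn (q0.mul q2)).add
      ((BoundedOn.const _).mul_dominatedOn (q1.mul q1))).add
      (((BoundedOn.const _).mul (b0.pow 2)).mul_dominatedOn (q0.mul q0)))
    DominatedOn.zero DominatedOn.zero
  simp only [integral_zero, intervalIntegral.integral_zero, ← sq] at key
  linarith

/-- Conservation of energy. -/
theorem energy_eq (hu : IsSolution u) {s t B : ℝ} (hst : s ≤ t)
    (hB : ∀ τ ∈ Set.Icc s t, sobolevSq u τ ≤ B) :
    (1 / 2 * ∫ x, xDeriv u 1 t x ^ 2) - 1 / 4 * ∫ x, xDeriv u 0 t x ^ 4 =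
      (1 / 2 * ∫ x, xDeriv u 1 s x ^ 2) - 1 / 4 * ∫ x, xDeriv u 0 s x ^ 4 := by
  have hd := hasDerivAt_xDeriv hu.smooth
  have hc0 := continuous_xDeriv hu.smooth 0
  have hc1 := continuous_xDeriv hu.smooth 1
  have hc2 := continuous_xDeriv hu.smooth 2
  have hc3 := continuous_xDeriv hu.smooth 3
  have hc4 := continuous_xDeriv hu.smooth 4
  have b0 := hu.boundedOn_xDeriv hB (k := 0) (by norm_num)
  have q0 := sqDominatedOn_xDeriv u (Set.Icc s t) (k := 0) (by norm_num)
  have q1 := sqDominatedOn_xDeriv u (Set.Icc s t) (k := 1) (by norm_num)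
  have q2 := sqDominatedOn_xDeriv u (Set.Icc s t) (k := 2) (by norm_num)
  have q3 := sqDominatedOn_xDeriv u (Set.Icc s t) (k := 3) (by norm_num)
  have qP := q2.add ((b0.pow 2).mul_sqDominatedOn q0)
  have d4 := (b0.pow 2).mul_dominatedOn (q0.mul q0)
  have key := hu.integral_balance hst hB
    (e := fun τ x => 1 / 2 * (xDeriv u 1 τ x * xDeriv u 1 τ x)
      + (-(1 / 4)) * (xDeriv u 0 τ x ^ 2 * (xDeriv u 0 τ x * xDeriv u 0 τ x)))
    (J := fun τ x => xDeriv u 1 τ x * xDeriv u 3 τ x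
      + 3 * xDeriv u 0 τ x ^ 2 * (xDeriv u 1 τ x * xDeriv u 1 τ x)
      + (-(1 / 2)) * ((xDeriv u 2 τ x + xDeriv u 0 τ x ^ 2 * xDeriv u 0 τ x)
        * (xDeriv u 2 τ x + xDeriv u 0 τ x ^ 2 * xDeriv u 0 τ x)))
    (J' := fun τ x => xDeriv u 2 τ x * xDeriv u 3 τ x + xDeriv u 1 τ x * xDeriv u 4 τ x
      + 6 * xDeriv u 0 τ x * xDeriv u 1 τ x ^ 3
      + 6 * xDeriv u 0 τ x ^ 2 * xDeriv u 1 τ x * xDeriv u 2 τ x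
      - (xDeriv u 2 τ x + xDeriv u 0 τ x ^ 3)
        * (xDeriv u 3 τ x + 3 * xDeriv u 0 τ x ^ 2 * xDeriv u 1 τ x))
    (A := fun _ _ => 0) (A' := fun _ _ => 0) (A'' := fun _ _ => 0) (g := fun _ _ => 0)
    (by fun_prop) (by fun_prop) (by fun_prop) (by fun_prop) (by fun_prop) (by fun_prop)
    (by fun_prop)
    (fun τ x => by
      have hP := (hd 2 τ x).fun_add (((hd 0 τ x).fun_pow 2).fun_mul (hd 0 τ x))
      exact ((((hd 1 τ x).fun_mul (hd 3 τ x)).fun_add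
        ((((hd 0 τ x).fun_pow 2).const_mul 3).fun_mul ((hd 1 τ x).fun_mul (hd 1 τ x)))).fun_add
        ((hP.fun_mul hP).const_mul (-(1 / 2)))).congr_deriv (by push_cast; ring))
    (fun _ _ => hasDerivAt_const _ _) (fun _ _ => hasDerivAt_const _ _)
    (fun τ x => by
      have h0 := hu.hasDerivAt_time_zero τ x
      have h1 := hu.hasDerivAt_time_one τ x
      exact (((h1.fun_mul h1).const_mul (1 / 2)).fun_add
        (((h0.fun_pow 2).fun_mul (h0.fun_mul h0)).const_mul (-(1 / 4)))).congr_deriv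
        (by push_cast; ring))
    (((BoundedOn.const _).mul_dominatedOn (q1.mul q1)).add
      ((BoundedOn.const _).mul_dominatedOn d4))
    (((q1.mul q3).add (((BoundedOn.const _).mul (b0.pow 2)).mul_dominatedOn (q1.mul q1))).add
      ((BoundedOn.const _).mul_dominatedOn (qP.mul qP)))
    DominatedOn.zero DominatedOn.zero
  simp only [integral_zero, intervalIntegral.integral_zero] at key
  have hsplit : ∀ τ ∈ Set.Icc s t, ∫ x, (1 / 2 * (xDeriv u 1 τ x * xDeriv u 1 τ x)
      + (-(1 / 4)) * (xDeriv u 0 τ x ^ 2 * (xDeriv u 0 τ x * xDeriv u 0 τ x)))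
      = (1 / 2 * ∫ x, xDeriv u 1 τ x ^ 2) - 1 / 4 * ∫ x, xDeriv u 0 τ x ^ 4 := by
    intro τ hτ
    have hi4 : Integrable fun x => xDeriv u 0 τ x ^ 2 * (xDeriv u 0 τ x * xDeriv u 0 τ x) :=
      d4.integrable (by simp only [Function.uncurry_def]; fun_prop) hτ
        (hu.integrable_sobolevDensity τ)
    have hi1 : Integrable fun x => xDeriv u 1 τ x * xDeriv u 1 τ x := by
      simpa only [← sq] using hu.integrable_xDeriv_sq τ (k := 1) (by norm_num)
    rw [integral_add (hi1.const_mul _) (hi4.const_mul _), integral_const_mul, integral_const_mul]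
    ring_nf
  rw [hsplit t (Set.right_mem_Icc.2 hst), hsplit s (Set.left_mem_Icc.2 hst)] at key
  linarith

/-- Conservation of the second order energy. -/
theorem second_energy_eq (hu : IsSolution u) {s t B : ℝ} (hst : s ≤ t)
    (hB : ∀ τ ∈ Set.Icc s t, sobolevSq u τ ≤ B) :
    (1 / 2 * ∫ x, xDeriv u 2 t x ^ 2) - (5 / 2 * ∫ x, xDeriv u 0 t x ^ 2 * xDeriv u 1 t x ^ 2)
        + 1 / 4 * ∫ x, xDeriv u 0 t x ^ 6 =
      (1 / 2 * ∫ x, xDeriv u 2 s x ^ 2) - (5 / 2 * ∫ x, xDeriv u 0 s x ^ 2 * xDeriv u 1 s x ^ 2)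
        + 1 / 4 * ∫ x, xDeriv u 0 s x ^ 6 := by
  have hd := hasDerivAt_xDeriv hu.smooth
  have hc0 := continuous_xDeriv hu.smooth 0
  have hc1 := continuous_xDeriv hu.smooth 1
  have hc2 := continuous_xDeriv hu.smooth 2
  have hc3 := continuous_xDeriv hu.smooth 3
  have hc4 := continuous_xDeriv hu.smooth 4
  have hc5 := continuous_xDeriv hu.smooth 5
  have b0 := hu.boundedOn_xDeriv hB (k := 0) (by norm_num)
  have b1 := hu.boundedOn_xDeriv hB (k := 1) (by norm_num)
  have q0 := sqDominatedOn_xDeriv u (Set.Icc s t) (k := 0) (by norm_num)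
  have q1 := sqDominatedOn_xDeriv u (Set.Icc s t) (k := 1) (by norm_num)
  have q2 := sqDominatedOn_xDeriv u (Set.Icc s t) (k := 2) (by norm_num)
  have q3 := sqDominatedOn_xDeriv u (Set.Icc s t) (k := 3) (by norm_num)
  have d2 := (b0.pow 2).mul_dominatedOn (q1.mul q1)
  have d6 := (b0.pow 4).mul_dominatedOn (q0.mul q0)
  have key := hu.integral_balance hst hB
    (e := fun τ x => 1 / 2 * (xDeriv u 2 τ x * xDeriv u 2 τ x)
      + (-(5 / 2)) * (xDeriv u 0 τ x ^ 2 * (xDeriv u 1 τ x * xDeriv u 1 τ x))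
      + 1 / 4 * (xDeriv u 0 τ x ^ 4 * (xDeriv u 0 τ x * xDeriv u 0 τ x)))
    (J := fun τ x => (-(3 / 2)) * (xDeriv u 3 τ x * xDeriv u 3 τ x)
      + (-5) * xDeriv u 0 τ x ^ 2 * (xDeriv u 1 τ x * xDeriv u 3 τ x)
      + 4 * xDeriv u 0 τ x ^ 2 * (xDeriv u 2 τ x * xDeriv u 2 τ x)
      + 5 * (xDeriv u 0 τ x * xDeriv u 1 τ x) * (xDeriv u 1 τ x * xDeriv u 2 τ x)
      + 1 / 4 * xDeriv u 1 τ x ^ 2 * (xDeriv u 1 τ x * xDeriv u 1 τ x)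
      + 3 / 2 * xDeriv u 0 τ x ^ 4 * (xDeriv u 0 τ x * xDeriv u 2 τ x)
      + (-(45 / 4)) * xDeriv u 0 τ x ^ 4 * (xDeriv u 1 τ x * xDeriv u 1 τ x)
      + 9 / 16 * xDeriv u 0 τ x ^ 6 * (xDeriv u 0 τ x * xDeriv u 0 τ x))
    (J' := fun τ x => -3 * xDeriv u 3 τ x * xDeriv u 4 τ x
      - 10 * xDeriv u 0 τ x * xDeriv u 1 τ x ^ 2 * xDeriv u 3 τ x
      - 5 * xDeriv u 0 τ x ^ 2 * (xDeriv u 2 τ x * xDeriv u 3 τ x + xDeriv u 1 τ x * xDeriv u 4 τ x)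
      + 8 * xDeriv u 0 τ x * xDeriv u 1 τ x * xDeriv u 2 τ x ^ 2
      + 8 * xDeriv u 0 τ x ^ 2 * xDeriv u 2 τ x * xDeriv u 3 τ x
      + 5 * xDeriv u 1 τ x ^ 3 * xDeriv u 2 τ x
      + 10 * xDeriv u 0 τ x * xDeriv u 1 τ x * xDeriv u 2 τ x ^ 2
      + 5 * xDeriv u 0 τ x * xDeriv u 1 τ x ^ 2 * xDeriv u 3 τ x
      + xDeriv u 1 τ x ^ 3 * xDeriv u 2 τ x
      + 15 / 2 * xDeriv u 0 τ x ^ 4 * xDeriv u 1 τ x * xDeriv u 2 τ x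
      + 3 / 2 * xDeriv u 0 τ x ^ 5 * xDeriv u 3 τ x
      - 45 * xDeriv u 0 τ x ^ 3 * xDeriv u 1 τ x ^ 3
      - 45 / 2 * xDeriv u 0 τ x ^ 4 * xDeriv u 1 τ x * xDeriv u 2 τ x
      + 9 / 2 * xDeriv u 0 τ x ^ 7 * xDeriv u 1 τ x)
    (A := fun τ x => xDeriv u 2 τ x * xDeriv u 3 τ x)
    (A' := fun τ x => xDeriv u 3 τ x * xDeriv u 3 τ x + xDeriv u 2 τ x * xDeriv u 4 τ x)
    (A'' := fun τ x => 3 * xDeriv u 3 τ x * xDeriv u 4 τ x + xDeriv u 2 τ x * xDeriv u 5 τ x)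
    (g := fun _ _ => 0)
    (by fun_prop) (by fun_prop) (by fun_prop) (by fun_prop) (by fun_prop) (by fun_prop)
    (by fun_prop)
    (fun τ x => by
      have h0 := hd 0 τ x
      have h1 := hd 1 τ x
      have h2 := hd 2 τ x
      have h3 := hd 3 τ x
      exact ((((((((h3.fun_mul h3).const_mul (-(3 / 2))).fun_add
        (((h0.fun_pow 2).const_mul (-5)).fun_mul (h1.fun_mul h3))).fun_add
        (((h0.fun_pow 2).const_mul 4).fun_mul (h2.fun_mul h2))).fun_add
        (((h0.fun_mul h1).const_mul 5).fun_mul (h1.fun_mul h2))).fun_add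
        (((h1.fun_pow 2).const_mul (1 / 4)).fun_mul (h1.fun_mul h1))).fun_add
        (((h0.fun_pow 4).const_mul (3 / 2)).fun_mul (h0.fun_mul h2))).fun_add
        (((h0.fun_pow 4).const_mul (-(45 / 4))).fun_mul (h1.fun_mul h1))).fun_add
        (((h0.fun_pow 6).const_mul (9 / 16)).fun_mul (h0.fun_mul h0)) |>.congr_deriv
        (by push_cast; ring))
    (fun τ x => (hd 2 τ x).fun_mul (hd 3 τ x))
    (fun τ x => (((hd 3 τ x).fun_mul (hd 3 τ x)).fun_add
      ((hd 2 τ x).fun_mul (hd 4 τ x))).congr_deriv (by ring))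
    (fun τ x => by
      have h0 := hu.hasDerivAt_time_zero τ x
      have h1 := hu.hasDerivAt_time_one τ x
      have h2 := hu.hasDerivAt_time_two τ x
      exact ((((h2.fun_mul h2).const_mul (1 / 2)).fun_add
        (((h0.fun_pow 2).fun_mul (h1.fun_mul h1)).const_mul (-(5 / 2)))).fun_add
        (((h0.fun_pow 4).fun_mul (h0.fun_mul h0)).const_mul (1 / 4))).congr_deriv
        (by push_cast; ring))
    ((((BoundedOn.const _).mul_dominatedOn (q2.mul q2)).add
      ((BoundedOn.const _).mul_dominatedOn d2)).add ((BoundedOn.const _).mul_dominatedOn d6))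
    (((((((((BoundedOn.const _).mul_dominatedOn (q3.mul q3)).add
      (((BoundedOn.const _).mul (b0.pow 2)).mul_dominatedOn (q1.mul q3))).add
      (((BoundedOn.const _).mul (b0.pow 2)).mul_dominatedOn (q2.mul q2))).add
      (((BoundedOn.const _).mul (b0.mul b1)).mul_dominatedOn (q1.mul q2))).add
      (((BoundedOn.const _).mul (b1.pow 2)).mul_dominatedOn (q1.mul q1))).add
      (((BoundedOn.const _).mul (b0.pow 4)).mul_dominatedOn (q0.mul q2))).add
      (((BoundedOn.const _).mul (b0.pow 4)).mul_dominatedOn (q1.mul q1))).add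
      (((BoundedOn.const _).mul (b0.pow 6)).mul_dominatedOn (q0.mul q0)))
    (q2.mul q3) DominatedOn.zero
  simp only [integral_zero, intervalIntegral.integral_zero] at key
  have hsplit : ∀ τ ∈ Set.Icc s t, ∫ x, (1 / 2 * (xDeriv u 2 τ x * xDeriv u 2 τ x)
      + (-(5 / 2)) * (xDeriv u 0 τ x ^ 2 * (xDeriv u 1 τ x * xDeriv u 1 τ x))
      + 1 / 4 * (xDeriv u 0 τ x ^ 4 * (xDeriv u 0 τ x * xDeriv u 0 τ x)))
      = (1 / 2 * ∫ x, xDeriv u 2 τ x ^ 2)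
        - (5 / 2 * ∫ x, xDeriv u 0 τ x ^ 2 * xDeriv u 1 τ x ^ 2)
        + 1 / 4 * ∫ x, xDeriv u 0 τ x ^ 6 := by
    intro τ hτ
    have hi6 : Integrable fun x => xDeriv u 0 τ x ^ 4 * (xDeriv u 0 τ x * xDeriv u 0 τ x) :=
      d6.integrable (by simp only [Function.uncurry_def]; fun_prop) hτ
        (hu.integrable_sobolevDensity τ)
    have hi2 : Integrable fun x => xDeriv u 0 τ x ^ 2 * (xDeriv u 1 τ x * xDeriv u 1 τ x) :=
      d2.integrable (by simp only [Function.uncurry_def]; fun_prop) hτ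
        (hu.integrable_sobolevDensity τ)
    have hi1 : Integrable fun x => xDeriv u 2 τ x * xDeriv u 2 τ x := by
      simpa only [← sq] using hu.integrable_xDeriv_sq τ (k := 2) (by norm_num)
    have hi12 : Integrable fun x => 1 / 2 * (xDeriv u 2 τ x * xDeriv u 2 τ x)
        + (-(5 / 2)) * (xDeriv u 0 τ x ^ 2 * (xDeriv u 1 τ x * xDeriv u 1 τ x)) :=
      (hi1.const_mul _).add (hi2.const_mul _)
    rw [integral_add hi12 (hi6.const_mul _), integral_add (hi1.const_mul _) (hi2.const_mul _),
      integral_const_mul, integral_const_mul, integral_const_mul]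
    ring_nf
  rw [hsplit t (Set.right_mem_Icc.2 hst), hsplit s (Set.left_mem_Icc.2 hst)] at key
  linarith

end IsSolution

/-- Gronwall stability in `L²` of solutions of mKdV with respect to the data and the forcing. -/
theorem IsSolution.integral_sub_sq_le {u v h : ℝ → ℝ → ℝ} (hu : IsSolution u)
    (hv : IsForcedSolution v h) {s t B M δ H : ℝ} (hst : s ≤ t) (hδ : 0 < δ)
    (huB : ∀ τ ∈ Set.Icc s t, sobolevSq u τ ≤ B) (hvB : ∀ τ ∈ Set.Icc s t, sobolevSq v τ ≤ B)
    (huM : ∀ k, k ≤ 1 → ∀ τ ∈ Set.Icc s t, ∀ x, |xDeriv u k τ x| ≤ M)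
    (hvM : ∀ k, k ≤ 1 → ∀ τ ∈ Set.Icc s t, ∀ x, |xDeriv v k τ x| ≤ M)
    (hhc : Continuous fun p : ℝ × ℝ => h p.1 p.2)
    (hhv : SqDominatedOn (Set.Icc s t) (sobolevDensity v) h)
    (hhH : ∀ τ ∈ Set.Icc s t, ∫ x, h τ x ^ 2 ≤ H) :
    ∫ x, (xDeriv u 0 t x - xDeriv v 0 t x) ^ 2 ≤ Real.exp ((6 * M ^ 2 + δ⁻¹) * (t - s)) *
      ((∫ x, (xDeriv u 0 s x - xDeriv v 0 s x) ^ 2) + δ * H * (t - s)) := by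
  set I := Set.Icc s t
  set l : ℝ := 6 * M ^ 2 + δ⁻¹ with hl
  set ρ : ℝ → ℝ → ℝ := fun τ x => sobolevDensity u τ x + sobolevDensity v τ x with hρ
  have hl0 : 0 ≤ l := by positivity
  have hdu := hasDerivAt_xDeriv hu.smooth
  have hdv := hasDerivAt_xDeriv hv.smooth
  have hcu0 := continuous_xDeriv hu.smooth 0
  have hcu1 := continuous_xDeriv hu.smooth 1
  have hcu2 := continuous_xDeriv hu.smooth 2
  have hcu3 := continuous_xDeriv hu.smooth 3
  have hcv0 := continuous_xDeriv hv.smooth 0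
  have hcv1 := continuous_xDeriv hv.smooth 1
  have hcv2 := continuous_xDeriv hv.smooth 2
  have hcv3 := continuous_xDeriv hv.smooth 3
  have hρu : ∀ {G}, SqDominatedOn I (sobolevDensity u) G → SqDominatedOn I ρ G := fun hG =>
    hG.mono fun τ _ x => le_add_of_nonneg_right (sobolevDensity_nonneg v τ x)
  have hρv : ∀ {G}, SqDominatedOn I (sobolevDensity v) G → SqDominatedOn I ρ G := fun hG =>
    hG.mono fun τ _ x => le_add_of_nonneg_left (sobolevDensity_nonneg u τ x)
  have qw : ∀ {k}, k ≤ 3 → SqDominatedOn I ρ fun τ x => xDeriv u k τ x - xDeriv v k τ x :=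
    fun hk => (hρu (sqDominatedOn_xDeriv u I hk)).sub (hρv (sqDominatedOn_xDeriv v I hk))
  have w0 := qw (k := 0) (by norm_num)
  have w1 := qw (k := 1) (by norm_num)
  have w2 := qw (k := 2) (by norm_num)
  have qh := hρv hhv
  have bu0 : BoundedOn I (xDeriv u 0) := ⟨M, huM 0 (by norm_num)⟩
  have bu1 : BoundedOn I (xDeriv u 1) := ⟨M, huM 1 le_rfl⟩
  have bv0 : BoundedOn I (xDeriv v 0) := ⟨M, hvM 0 (by norm_num)⟩
  have bv1 : BoundedOn I (xDeriv v 1) := ⟨M, hvM 1 le_rfl⟩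
  have bE : BoundedOn I fun τ _ => Real.exp (-l * (τ - s)) := by
    refine ⟨1, fun τ hτ _ => ?_⟩
    rw [abs_of_pos (Real.exp_pos _)]
    exact Real.exp_le_one_iff.2 (by nlinarith [hτ.1])
  have hρi : ∀ τ ∈ I, Integrable (ρ τ) := fun τ _ =>
    (hu.integrable_sobolevDensity τ).add (hv.integrable_sobolevDensity τ)
  have hρB : ∀ τ ∈ I, ∫ x, ρ τ x ≤ B + B := fun τ hτ => by
    rw [hρ, integral_add (hu.integrable_sobolevDensity τ) (hv.integrable_sobolevDensity τ)]
    exact add_le_add (huB τ hτ) (hvB τ hτ)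
  set g : ℝ → ℝ → ℝ := fun τ x => Real.exp (-l * (τ - s)) *
      ((-(1 / 2)) * (2 * (xDeriv u 0 τ x * xDeriv u 1 τ x) + xDeriv u 1 τ x * xDeriv v 0 τ x
          + xDeriv u 0 τ x * xDeriv v 1 τ x + 2 * (xDeriv v 0 τ x * xDeriv v 1 τ x)) *
          ((xDeriv u 0 τ x - xDeriv v 0 τ x) * (xDeriv u 0 τ x - xDeriv v 0 τ x))
        + (-1) * ((xDeriv u 0 τ x - xDeriv v 0 τ x) * h τ x)
        + (-(1 / 2) * l) * ((xDeriv u 0 τ x - xDeriv v 0 τ x)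
            * (xDeriv u 0 τ x - xDeriv v 0 τ x))) with hg
  have hgc : Continuous (Function.uncurry g) := by
    simp only [hg, Function.uncurry_def]; fun_prop
  have hgρ : DominatedOn I ρ g :=
    bE.mul_dominatedOn ((((((BoundedOn.const _).mul (((((BoundedOn.const _).mul (bu0.mul bu1)).add
      (bu1.mul bv0)).add (bu0.mul bv1)).add ((BoundedOn.const _).mul (bv0.mul bv1))))).mul_dominatedOn
      (w0.mul w0)).add ((BoundedOn.const _).mul_dominatedOn (w0.mul qh))).add
      ((BoundedOn.const _).mul_dominatedOn (w0.mul w0)))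
  have key := integral_sub_integral_of_dominatedOn hst (ρ := ρ) (B := B + B)
    (e := fun τ x => Real.exp (-l * (τ - s)) * (1 / 2 *
      ((xDeriv u 0 τ x - xDeriv v 0 τ x) * (xDeriv u 0 τ x - xDeriv v 0 τ x))))
    (J := fun τ x => Real.exp (-l * (τ - s)) *
      ((xDeriv u 0 τ x - xDeriv v 0 τ x) * (xDeriv u 2 τ x - xDeriv v 2 τ x)
        + (-(1 / 2)) * ((xDeriv u 1 τ x - xDeriv v 1 τ x) * (xDeriv u 1 τ x - xDeriv v 1 τ x))
        + 1 / 2 * (xDeriv u 0 τ x ^ 2 + xDeriv u 0 τ x * xDeriv v 0 τ x + xDeriv v 0 τ x ^ 2) *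
          ((xDeriv u 0 τ x - xDeriv v 0 τ x) * (xDeriv u 0 τ x - xDeriv v 0 τ x))))
    (J' := fun τ x => Real.exp (-l * (τ - s)) *
      ((xDeriv u 0 τ x - xDeriv v 0 τ x) * (xDeriv u 3 τ x - xDeriv v 3 τ x)
        + 1 / 2 * (2 * (xDeriv u 0 τ x * xDeriv u 1 τ x) + xDeriv u 1 τ x * xDeriv v 0 τ x
          + xDeriv u 0 τ x * xDeriv v 1 τ x + 2 * (xDeriv v 0 τ x * xDeriv v 1 τ x)) *
          (xDeriv u 0 τ x - xDeriv v 0 τ x) ^ 2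
        + (xDeriv u 0 τ x ^ 2 + xDeriv u 0 τ x * xDeriv v 0 τ x + xDeriv v 0 τ x ^ 2) *
          ((xDeriv u 0 τ x - xDeriv v 0 τ x) * (xDeriv u 1 τ x - xDeriv v 1 τ x))))
    (A := fun _ _ => 0) (A' := fun _ _ => 0) (A'' := fun _ _ => 0) (g := g)
    (fun τ x => add_nonneg (sobolevDensity_nonneg u τ x) (sobolevDensity_nonneg v τ x)) hρi hρB
    (by simp only [Function.uncurry_def]; fun_prop) (by simp only [Function.uncurry_def]; fun_prop)
    (by simp only [Function.uncurry_def]; fun_prop) (by simp only [Function.uncurry_def]; fun_prop)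
    (by simp only [Function.uncurry_def]; fun_prop) (by simp only [Function.uncurry_def]; fun_prop)
    hgc
    (fun τ x => by
      have hw0 := (hdu 0 τ x).fun_sub (hdv 0 τ x)
      have hw1 := (hdu 1 τ x).fun_sub (hdv 1 τ x)
      have hw2 := (hdu 2 τ x).fun_sub (hdv 2 τ x)
      have hq := ((((hdu 0 τ x).fun_pow 2).fun_add ((hdu 0 τ x).fun_mul (hdv 0 τ x))).fun_add
        ((hdv 0 τ x).fun_pow 2)).const_mul (1 / 2)
      exact ((((hw0.fun_mul hw2).fun_add ((hw1.fun_mul hw1).const_mul (-(1 / 2)))).fun_add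
        (hq.fun_mul (hw0.fun_mul hw0))).const_mul (Real.exp (-l * (τ - s)))).congr_deriv
        (by push_cast; ring))
    (fun _ _ => hasDerivAt_const _ _) (fun _ _ => hasDerivAt_const _ _)
    (fun τ x => by
      have hw := (hu.hasDerivAt_time_zero τ x).fun_sub (hv.time τ x)
      have hE : HasDerivAt (fun σ => Real.exp (-l * (σ - s))) (Real.exp (-l * (τ - s)) * (-l)) τ :=
        ((((hasDerivAt_id τ).sub_const s).const_mul (-l)).exp).congr_deriv (by simp)
      exact (hE.fun_mul ((hw.fun_mul hw).const_mul (1 / 2))).congr_deriv (by rw [hg]; ring))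
    (bE.mul_dominatedOn ((BoundedOn.const _).mul_dominatedOn (w0.mul w0)))
    (bE.mul_dominatedOn (((w0.mul w2).add ((BoundedOn.const _).mul_dominatedOn (w1.mul w1))).add
      (((BoundedOn.const _).mul (((bu0.pow 2).add (bu0.mul bv0)).add (bv0.pow 2))).mul_dominatedOn
        (w0.mul w0))))
    DominatedOn.zero hgρ
  have hgle : ∀ τ ∈ I, ∫ x, g τ x ≤ δ / 2 * H := by
    intro τ hτ
    have hih : Integrable fun x => h τ x ^ 2 := by
      obtain ⟨C, hC, hh⟩ := hhv
      refine ((hv.integrable_sobolevDensity τ).const_mul C).mono' ?_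
        (Filter.Eventually.of_forall fun x => ?_)
      · exact ((hhc.comp (by fun_prop : Continuous fun x : ℝ => (τ, x))).pow 2).aestronglyMeasurable
      · rw [Real.norm_of_nonneg (sq_nonneg _)]
        exact hh τ hτ x
    calc ∫ x, g τ x ≤ ∫ x, δ / 2 * h τ x ^ 2 := by
          refine integral_mono (hgρ.integrable hgc hτ (hρi τ hτ)) (hih.const_mul _) fun x => ?_
          have hab : ∀ {a b : ℝ}, |a| ≤ M → |b| ≤ M → -(a * b) ≤ M ^ 2 := fun ha hb =>
            (neg_le_abs _).trans (by
              rw [abs_mul, sq]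
              exact mul_le_mul ha hb (abs_nonneg _) ((abs_nonneg _).trans ha))
          have m1 := hab (huM 0 (by norm_num) τ hτ x) (huM 1 le_rfl τ hτ x)
          have m2 := hab (huM 1 le_rfl τ hτ x) (hvM 0 (by norm_num) τ hτ x)
          have m3 := hab (huM 0 (by norm_num) τ hτ x) (hvM 1 le_rfl τ hτ x)
          have m4 := hab (hvM 0 (by norm_num) τ hτ x) (hvM 1 le_rfl τ hτ x)
          have hE1 : Real.exp (-l * (τ - s)) ≤ 1 :=
            Real.exp_le_one_iff.2 (by nlinarith [hτ.1])
          have hE0 := Real.exp_pos (-l * (τ - s))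
          have hyoung : -((xDeriv u 0 τ x - xDeriv v 0 τ x) * h τ x) ≤
              1 / 2 * δ⁻¹ * (xDeriv u 0 τ x - xDeriv v 0 τ x) ^ 2 + δ / 2 * h τ x ^ 2 := by
            have := mul_nonneg (inv_pos.2 hδ).le
              (sq_nonneg ((xDeriv u 0 τ x - xDeriv v 0 τ x) + δ * h τ x))
            have e1 : δ⁻¹ * ((xDeriv u 0 τ x - xDeriv v 0 τ x) + δ * h τ x) ^ 2 =
                δ⁻¹ * (xDeriv u 0 τ x - xDeriv v 0 τ x) ^ 2
                + 2 * ((xDeriv u 0 τ x - xDeriv v 0 τ x) * h τ x) + δ * h τ x ^ 2 := by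
              field_simp
              ring
            linarith
          suffices hs :
            ((-(1 / 2)) * (2 * (xDeriv u 0 τ x * xDeriv u 1 τ x) + xDeriv u 1 τ x * xDeriv v 0 τ x
                + xDeriv u 0 τ x * xDeriv v 1 τ x + 2 * (xDeriv v 0 τ x * xDeriv v 1 τ x)) *
                ((xDeriv u 0 τ x - xDeriv v 0 τ x) * (xDeriv u 0 τ x - xDeriv v 0 τ x))
              + (-1) * ((xDeriv u 0 τ x - xDeriv v 0 τ x) * h τ x)
              + (-(1 / 2) * l) * ((xDeriv u 0 τ x - xDeriv v 0 τ x)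
                  * (xDeriv u 0 τ x - xDeriv v 0 τ x))) ≤ δ / 2 * h τ x ^ 2 from
            (mul_le_mul_of_nonneg_left hs hE0.le).trans
              (mul_le_of_le_one_left (mul_nonneg (half_pos hδ).le (sq_nonneg _)) hE1)
          have hq := mul_le_mul_of_nonneg_right (show -(2 * (xDeriv u 0 τ x * xDeriv u 1 τ x)
            + xDeriv u 1 τ x * xDeriv v 0 τ x + xDeriv u 0 τ x * xDeriv v 1 τ x
            + 2 * (xDeriv v 0 τ x * xDeriv v 1 τ x)) ≤ 6 * M ^ 2 by linarith)
            (sq_nonneg (xDeriv u 0 τ x - xDeriv v 0 τ x))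
          rw [hl]
          linarith
      _ = δ / 2 * ∫ x, h τ x ^ 2 := integral_const_mul _ _
      _ ≤ _ := mul_le_mul_of_nonneg_left (hhH τ hτ) (by positivity)
  have hfin := intervalIntegral_integral_le_of_dominatedOn hst hρi hρB hgc hgρ hgle
  rw [← key] at hfin
  simp only [integral_const_mul, sub_self, mul_zero, Real.exp_zero, one_mul, ← sq] at hfin
  have hE : Real.exp (l * (t - s)) * Real.exp (-l * (t - s)) = 1 := by
    rw [← Real.exp_add]; simp
  have := mul_le_mul_of_nonneg_left hfin (Real.exp_pos (l * (t - s))).le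
  rw [mul_sub, ← mul_assoc, hE] at this
  linarith

/-- A consequence of Fatou's lemma for real-valued integrals. -/
theorem integral_le_of_tendsto_of_forall_integral_le {F : ℕ → ℝ → ℝ} {f : ℝ → ℝ} {C : ℝ}
    (hF : ∀ n x, 0 ≤ F n x) (hFc : ∀ n, Continuous (F n)) (hFi : ∀ n, Integrable (F n))
    (hC : ∀ n, ∫ x, F n x ≤ C) (hf : Continuous f)
    (hlim : ∀ x, Filter.Tendsto (fun n => F n x) Filter.atTop (nhds (f x))) :
    ∫ x, f x ≤ C := by
  have hf0 : ∀ x, 0 ≤ f x := fun x => ge_of_tendsto' (hlim x) fun n => hF n x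
  have hC0 : 0 ≤ C := (integral_nonneg (hF 0)).trans (hC 0)
  rw [integral_eq_lintegral_of_nonneg_ae (Filter.Eventually.of_forall hf0)
    hf.aestronglyMeasurable]
  refine ENNReal.toReal_le_of_le_ofReal hC0 ?_
  have hlim' : ∀ x, Filter.liminf (fun n => ENNReal.ofReal (F n x)) Filter.atTop
      = ENNReal.ofReal (f x) := fun x =>
    ((ENNReal.continuous_ofReal.tendsto _).comp (hlim x)).liminf_eq
  calc ∫⁻ x, ENNReal.ofReal (f x)
      = ∫⁻ x, Filter.liminf (fun n => ENNReal.ofReal (F n x)) Filter.atTop := by simp only [hlim']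
    _ ≤ Filter.liminf (fun n => ∫⁻ x, ENNReal.ofReal (F n x)) Filter.atTop :=
        lintegral_liminf_le fun n => ((hFc n).measurable).ennreal_ofReal
    _ ≤ ENNReal.ofReal C := by
        refine Filter.liminf_le_of_le (by isBoundedDefault) fun b hb => ?_
        obtain ⟨n, hn⟩ := hb.exists
        rw [← ofReal_integral_eq_lintegral_ofReal (hFi n)
          (Filter.Eventually.of_forall (hF n))] at hn
        exact hn.trans (ENNReal.ofReal_le_ofReal (hC n))

theorem IsForcedSolution.integral_mul_xDeriv_sq_le {u h : ℝ → ℝ → ℝ} (hu : IsForcedSolution u h)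
    (t : ℝ) {k : ℕ} (hk : k ≤ 3) {p : ℝ → ℝ} {P : ℝ} (hp : ∀ x, 0 ≤ p x) (hpP : ∀ x, p x ≤ P) :
    ∫ x, p x * xDeriv u k t x ^ 2 ≤ P * ∫ x, xDeriv u k t x ^ 2 := by
  rw [← integral_const_mul]
  exact integral_mono_of_nonneg
    (Filter.Eventually.of_forall fun x => mul_nonneg (hp x) (sq_nonneg _))
    ((hu.integrable_xDeriv_sq t hk).const_mul P)
    (Filter.Eventually.of_forall fun x => mul_le_mul_of_nonneg_right (hpP x) (sq_nonneg _))

namespace IsSolution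

variable {u : ℝ → ℝ → ℝ}

/-- The conservation laws bound the second order Sobolev norm forward in time. -/
theorem exists_integral_xDeriv_sq_le (hu : IsSolution u) {K : ℝ} (hK : 0 ≤ K) :
    ∃ L, 0 ≤ L ∧ ∀ s t B : ℝ, s ≤ t → (∀ τ ∈ Set.Icc s t, sobolevSq u τ ≤ B) →
      sobolevSq u s ≤ K → ∀ k, k ≤ 2 → ∫ x, xDeriv u k t x ^ 2 ≤ L := by
  set K₁ : ℝ := 2 * K + K ^ 2 * (1 + K) with hK₁
  set K₂ : ℝ := K + 1 / 2 * K ^ 3 + 5 * ((K₁ + K) * K₁) with hK₂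
  have hK₁0 : 0 ≤ K₁ := by positivity
  have hK₂0 : 0 ≤ K₂ := by positivity
  refine ⟨K + K₁ + K₂, by positivity, fun s t B hst hB hs => ?_⟩
  have hn : ∀ j τ, 0 ≤ ∫ x, xDeriv u j τ x ^ 2 := fun j τ => integral_nonneg fun x => sq_nonneg _
  have hs' := hu.sobolevSq_eq s
  have h0s := hn 0 s
  have h1s := hn 1 s
  have h2s := hn 2 s
  have h3s := hn 3 s
  have h0t := hn 0 t
  have h1t := hn 1 t
  have ha : ∫ x, xDeriv u 0 t x ^ 2 ≤ K := by
    rw [hu.mass_eq hst hB]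
    linarith
  have hsup : ∀ τ x {ε : ℝ}, 0 < ε → xDeriv u 0 τ x ^ 2 ≤
      ε * (∫ y, xDeriv u 1 τ y ^ 2) + ε⁻¹ * ∫ y, xDeriv u 0 τ y ^ 2 := fun τ x ε hε =>
    hu.xDeriv_sq_le τ x (k := 0) (by norm_num) hε
  have hb : ∫ x, xDeriv u 1 t x ^ 2 ≤ K₁ := by
    have hE := hu.energy_eq hst hB
    have h4s : 0 ≤ ∫ x, xDeriv u 0 s x ^ 4 := integral_nonneg fun x => by positivity
    have h4t : ∫ x, xDeriv u 0 t x ^ 4 ≤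
        ((1 + K)⁻¹ * (∫ y, xDeriv u 1 t y ^ 2) + (1 + K) * ∫ y, xDeriv u 0 t y ^ 2) *
          ∫ x, xDeriv u 0 t x ^ 2 := by
      have := hu.integral_mul_xDeriv_sq_le t (k := 0) (by norm_num)
        (p := fun x => xDeriv u 0 t x ^ 2) (fun x => sq_nonneg _)
        (fun x => hsup t x (inv_pos.2 (by positivity : 0 < 1 + K)))
      rw [inv_inv] at this
      calc _ = _ := by congr with x; ring
        _ ≤ _ := this
    have e1 : (1 + K)⁻¹ * K ≤ 1 := by
      rw [inv_mul_le_iff₀ (by positivity)]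
      linarith
    have e2 : ((1 + K)⁻¹ * (∫ y, xDeriv u 1 t y ^ 2) + (1 + K) * ∫ y, xDeriv u 0 t y ^ 2) *
        (∫ x, xDeriv u 0 t x ^ 2) ≤ (∫ y, xDeriv u 1 t y ^ 2) + (1 + K) * K * K := by
      have i1 : (1 + K)⁻¹ * (∫ x, xDeriv u 0 t x ^ 2) ≤ 1 :=
        (mul_le_mul_of_nonneg_left ha (by positivity)).trans e1
      have i2 := mul_le_mul_of_nonneg_right i1 h1t
      have i3 := mul_le_mul_of_nonneg_left (mul_le_mul ha ha h0t hK)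
        (by positivity : 0 ≤ 1 + K)
      linarith
    rw [hK₁]
    linarith
  have hc : ∫ x, xDeriv u 2 t x ^ 2 ≤ K₂ := by
    have hE := hu.second_energy_eq hst hB
    have h6t : 0 ≤ ∫ x, xDeriv u 0 t x ^ 6 := integral_nonneg fun x => by positivity
    have h22s : 0 ≤ ∫ x, xDeriv u 0 s x ^ 2 * xDeriv u 1 s x ^ 2 :=
      integral_nonneg fun x => by positivity
    have h22t : ∫ x, xDeriv u 0 t x ^ 2 * xDeriv u 1 t x ^ 2 ≤ (K₁ + K) * K₁ :=
      (hu.integral_mul_xDeriv_sq_le t (k := 1) (by norm_num) (p := fun x => xDeriv u 0 t x ^ 2)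
        (P := K₁ + K) (fun x => sq_nonneg _) (fun x => by
          have := hsup t x one_pos
          rw [inv_one] at this
          linarith)).trans (mul_le_mul_of_nonneg_left hb (by positivity))
    have h6s : ∫ x, xDeriv u 0 s x ^ 6 ≤ K ^ 2 * K := by
      have := hu.integral_mul_xDeriv_sq_le s (k := 0) (by norm_num)
        (p := fun x => xDeriv u 0 s x ^ 4) (P := K ^ 2) (fun x => by positivity) (fun x => by
          have := hsup s x one_pos
          rw [inv_one] at this
          calc xDeriv u 0 s x ^ 4 = (xDeriv u 0 s x ^ 2) ^ 2 := by ring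
            _ ≤ K ^ 2 := pow_le_pow_left₀ (sq_nonneg _) (by linarith) 2)
      calc _ = _ := by congr with x; ring
        _ ≤ _ := this
        _ ≤ _ := mul_le_mul_of_nonneg_left (by linarith) (by positivity)
    rw [hK₂]
    linarith
  intro k hk
  interval_cases k <;> linarith

/-- Quantitative continuity of a solution in `L²`. -/
theorem integral_sub_initial_sq_le (hu : IsSolution u) {s δ B K M : ℝ} (hδ : 0 < δ)
    (hB : ∀ τ ∈ Set.Icc s (s + δ), sobolevSq u τ ≤ B) (hK : sobolevSq u s ≤ K)
    (hM : ∀ k, k ≤ 1 → ∀ τ ∈ Set.Icc s (s + δ), ∀ x, |xDeriv u k τ x| ≤ M) :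
    ∫ x, (xDeriv u 0 (s + δ) x - xDeriv u 0 s x) ^ 2 ≤
      Real.exp (6 * M ^ 2 * δ + 1) * (((2 + 18 * M ^ 4) * K) * δ ^ 2) := by
  have hs : s ∈ Set.Icc s (s + δ) := ⟨le_rfl, by linarith⟩
  set h : ℝ → ℝ → ℝ := fun _ x => xDeriv u 3 s x + 3 * xDeriv u 0 s x ^ 2 * xDeriv u 1 s x
    with hh
  set v : ℝ → ℝ → ℝ := fun _ x => u s x with hv
  have hv' : IsForcedSolution v h :=
    { smooth := hu.smooth.comp (contDiff_const.prodMk contDiff_snd)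
      time := fun t x => (hasDerivAt_const t (u s x)).congr_deriv (sub_self _).symm
      decay := fun _ => hu.decay s }
  have hs1 := continuous_xDeriv hv'.smooth 0
  have hs2 := continuous_xDeriv hv'.smooth 1
  have hs3 := continuous_xDeriv hv'.smooth 3
  have hc : Continuous fun p : ℝ × ℝ =>
      xDeriv v 3 p.1 p.2 + 3 * xDeriv v 0 p.1 p.2 ^ 2 * xDeriv v 1 p.1 p.2 := by fun_prop
  have b0 : BoundedOn (Set.Icc s (s + δ)) (xDeriv v 0) := ⟨M, fun τ _ => hM 0 (by norm_num) s hs⟩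
  have hsd : SqDominatedOn (Set.Icc s (s + δ)) (sobolevDensity v) h :=
    (sqDominatedOn_xDeriv v _ (le_refl 3)).add (((BoundedOn.const 3).mul
      (b0.pow 2)).mul_sqDominatedOn (sqDominatedOn_xDeriv v _ (k := 1) (by norm_num)))
  have hH : ∫ x, (xDeriv u 3 s x + 3 * xDeriv u 0 s x ^ 2 * xDeriv u 1 s x) ^ 2 ≤
      (2 + 18 * M ^ 4) * K := by
    have hi3 := (hu.integrable_xDeriv_sq s (le_refl 3)).const_mul 2
    have hi1 := (hu.integrable_xDeriv_sq s (k := 1) (by norm_num)).const_mul (18 * M ^ 4)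
    have h0 : 0 ≤ ∫ x, xDeriv u 0 s x ^ 2 := integral_nonneg fun x => sq_nonneg _
    have h1 : 0 ≤ ∫ x, xDeriv u 1 s x ^ 2 := integral_nonneg fun x => sq_nonneg _
    have h2 : 0 ≤ ∫ x, xDeriv u 2 s x ^ 2 := integral_nonneg fun x => sq_nonneg _
    have h3 : 0 ≤ ∫ x, xDeriv u 3 s x ^ 2 := integral_nonneg fun x => sq_nonneg _
    have hN := hu.sobolevSq_eq s
    calc _ ≤ ∫ x, (2 * xDeriv u 3 s x ^ 2 + 18 * M ^ 4 * xDeriv u 1 s x ^ 2) := by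
          refine integral_mono_of_nonneg (Filter.Eventually.of_forall fun x => sq_nonneg _)
            (hi3.add hi1) (Filter.Eventually.of_forall fun x => ?_)
          have h4 : xDeriv u 0 s x ^ 4 ≤ M ^ 4 := by
            rw [← Even.pow_abs (by decide)]
            exact pow_le_pow_left₀ (abs_nonneg _) (hM 0 (by norm_num) s hs x) 4
          have := mul_le_mul_of_nonneg_right h4 (sq_nonneg (xDeriv u 1 s x))
          have := sq_nonneg (xDeriv u 3 s x - 3 * xDeriv u 0 s x ^ 2 * xDeriv u 1 s x)
          show (xDeriv u 3 s x + 3 * xDeriv u 0 s x ^ 2 * xDeriv u 1 s x) ^ 2 ≤ _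
          linarith
      _ = _ := by rw [integral_add hi3 hi1, integral_const_mul, integral_const_mul]
      _ ≤ (2 + 18 * M ^ 4) * ((∫ x, xDeriv u 3 s x ^ 2) + ∫ x, xDeriv u 1 s x ^ 2) := by
          have : 0 ≤ M ^ 4 * ∫ x, xDeriv u 3 s x ^ 2 := by positivity
          linarith
      _ ≤ _ := mul_le_mul_of_nonneg_left (by linarith) (by positivity)
  have key := hu.integral_sub_sq_le hv' (s := s) (t := s + δ) (B := B) (M := M) (δ := δ)
    (H := (2 + 18 * M ^ 4) * K) (by linarith) hδ hB (fun τ _ => hB s hs) hM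
    (fun k hk _ _ => hM k hk s hs) hc hsd (fun _ _ => hH)
  have e1 : ∫ x, (xDeriv u 0 s x - xDeriv v 0 s x) ^ 2 = 0 := by
    have : ∀ x, xDeriv u 0 s x - xDeriv v 0 s x = 0 := fun x => sub_self _
    simp [this]
  rw [e1, add_sub_cancel_left, zero_add, add_mul, inv_mul_cancel₀ hδ.ne'] at key
  refine key.trans (le_of_eq ?_)
  ring

theorem comp_add_right (hu : IsSolution u) (δ : ℝ) : IsSolution fun t x => u (t + δ) x where
  smooth := hu.smooth.comp ((contDiff_fst.add contDiff_const).prodMk contDiff_snd)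
  time t x := (hu.time (t + δ) x).comp_add_const t δ
  decay t := hu.decay (t + δ)

/-- Propagation of the `L²` bound on a time increment. -/
theorem integral_sub_shift_sq_le (hu : IsSolution u) {s t δ B M : ℝ} (hδ : 0 ≤ δ)
    (hst : s + δ ≤ t) (hB : ∀ τ ∈ Set.Icc s t, sobolevSq u τ ≤ B)
    (hM : ∀ k, k ≤ 1 → ∀ τ ∈ Set.Icc s t, ∀ x, |xDeriv u k τ x| ≤ M) :
    ∫ x, (xDeriv u 0 t x - xDeriv u 0 (t - δ) x) ^ 2 ≤ Real.exp ((6 * M ^ 2 + 1) * (t - δ - s)) *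
      ∫ x, (xDeriv u 0 (s + δ) x - xDeriv u 0 s x) ^ 2 := by
  have hsub : ∀ τ ∈ Set.Icc s (t - δ), τ ∈ Set.Icc s t := fun τ hτ => ⟨hτ.1, by linarith [hτ.2]⟩
  have hadd : ∀ τ ∈ Set.Icc s (t - δ), τ + δ ∈ Set.Icc s t := fun τ hτ =>
    ⟨by linarith [hτ.1], by linarith [hτ.2]⟩
  have key := (hu.comp_add_right δ).integral_sub_sq_le hu (s := s) (t := t - δ) (B := B) (M := M)
    (δ := 1) (H := 0) (by linarith) one_pos (fun τ hτ => hB _ (hadd τ hτ))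
    (fun τ hτ => hB _ (hsub τ hτ)) (fun k hk τ hτ => hM k hk _ (hadd τ hτ))
    (fun k hk τ hτ => hM k hk _ (hsub τ hτ)) continuous_const
    ⟨0, le_rfl, fun _ _ _ => by simp⟩ (fun _ _ => by simp)
  have e : ∀ τ x, xDeriv (fun t x => u (t + δ) x) 0 τ x = xDeriv u 0 (τ + δ) x := fun _ _ => rfl
  simp only [e, sub_add_cancel, inv_one, mul_zero, zero_mul, add_zero] at key
  exact key

end IsSolution

namespace IsSolution

variable {u : ℝ → ℝ → ℝ}

/-- The third order Sobolev norm is bounded forward in time as long as it is finite. -/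
theorem exists_sobolevSq_le_of_le (hu : IsSolution u) {K : ℝ} (hK : 0 ≤ K) :
    ∃ K', ∀ s t B : ℝ, s ≤ t → t - s ≤ 1 → (∀ τ ∈ Set.Icc s t, sobolevSq u τ ≤ B) →
      sobolevSq u s ≤ K → sobolevSq u t ≤ K' := by
  obtain ⟨L, hL0, hL⟩ := hu.exists_integral_xDeriv_sq_le hK
  set M : ℝ := √(2 * L) with hM
  set C : ℝ := Real.exp (6 * M ^ 2 + 1) * Real.exp (6 * M ^ 2 + 1) * ((2 + 18 * M ^ 4) * K) with hC
  refine ⟨max K (3 * L + (2 * C + 18 * M ^ 4 * L)), fun s t B hst hst1 hB hs => ?_⟩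
  rcases hst.eq_or_lt with rfl | hlt
  · exact hs.trans (le_max_left _ _)
  refine le_trans ?_ (le_max_right _ _)
  have hLr : ∀ τ ∈ Set.Icc s t, ∀ k, k ≤ 2 → ∫ x, xDeriv u k τ x ^ 2 ≤ L := fun τ hτ =>
    hL s τ B hτ.1 (fun σ hσ => hB σ ⟨hσ.1, hσ.2.trans hτ.2⟩) hs
  have hMr : ∀ k, k ≤ 1 → ∀ τ ∈ Set.Icc s t, ∀ x, |xDeriv u k τ x| ≤ M := by
    intro k hk τ hτ x
    refine Real.abs_le_sqrt ?_
    have h1 := hu.xDeriv_sq_le τ x (k := k) (by omega) one_pos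
    rw [inv_one] at h1
    linarith [hLr τ hτ k (by omega), hLr τ hτ (k + 1) (by omega)]
  have hincr : ∀ δ, 0 < δ → δ ≤ t - s →
      ∫ x, (xDeriv u 0 t x - xDeriv u 0 (t - δ) x) ^ 2 ≤ C * δ ^ 2 := by
    intro δ hδ hδt
    have h1 := hu.integral_sub_shift_sq_le hδ.le (by linarith) hB hMr
    have hsub : ∀ τ ∈ Set.Icc s (s + δ), τ ∈ Set.Icc s t := fun τ hτ =>
      ⟨hτ.1, by linarith [hτ.2]⟩
    have h2 := hu.integral_sub_initial_sq_le hδ (fun τ hτ => hB τ (hsub τ hτ)) hs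
      (fun k hk τ hτ => hMr k hk τ (hsub τ hτ))
    have hM2 : 0 ≤ M ^ 2 := sq_nonneg M
    have e1 : Real.exp ((6 * M ^ 2 + 1) * (t - δ - s)) ≤ Real.exp (6 * M ^ 2 + 1) :=
      Real.exp_le_exp.2 (mul_le_of_le_one_right (by positivity) (by linarith))
    have e2 : Real.exp (6 * M ^ 2 * δ + 1) ≤ Real.exp (6 * M ^ 2 + 1) :=
      Real.exp_le_exp.2 (by nlinarith)
    calc _ ≤ _ := h1
      _ ≤ Real.exp (6 * M ^ 2 + 1) * (Real.exp (6 * M ^ 2 * δ + 1) *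
          (((2 + 18 * M ^ 4) * K) * δ ^ 2)) :=
        mul_le_mul e1 h2 (integral_nonneg fun x => sq_nonneg _) (Real.exp_pos _).le
      _ ≤ Real.exp (6 * M ^ 2 + 1) * (Real.exp (6 * M ^ 2 + 1) *
          (((2 + 18 * M ^ 4) * K) * δ ^ 2)) :=
        mul_le_mul_of_nonneg_left (mul_le_mul_of_nonneg_right e2 (by positivity))
          (Real.exp_pos _).le
      _ = C * δ ^ 2 := by rw [hC]; ring
  set w : ℝ → ℝ := fun x => xDeriv u 3 t x + 3 * xDeriv u 0 t x ^ 2 * xDeriv u 1 t x with hw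
  have hcx : ∀ k τ, Continuous fun x => xDeriv u k τ x := fun k τ =>
    (continuous_xDeriv hu.smooth k).comp (by fun_prop : Continuous fun x : ℝ => (τ, x))
  have hc0 := hcx 0 t
  have hc1 := hcx 1 t
  have hc3 := hcx 3 t
  have hwc : Continuous w := by fun_prop
  have htmem : t ∈ Set.Icc s t := ⟨hst, le_rfl⟩
  have hwC : ∫ x, w x ^ 2 ≤ C := by
    set d : ℕ → ℝ := fun n => (t - s) / (n + 1) with hd
    have hts : 0 < t - s := sub_pos.2 hlt
    have hd0 : ∀ n, 0 < d n := fun n => by positivity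
    have hd1 : ∀ n, d n ≤ t - s := fun n => div_le_self hts.le (by simp)
    have hdlim : Filter.Tendsto d Filter.atTop (nhds 0) := by
      have := (tendsto_one_div_add_atTop_nhds_zero_nat (𝕜 := ℝ)).const_mul (t - s)
      simpa [hd, div_eq_mul_inv] using this
    have hi : ∀ n, Integrable fun x => (xDeriv u 0 t x - xDeriv u 0 (t - d n) x) ^ 2 := by
      intro n
      refine (((hu.integrable_xDeriv_sq t (k := 0) (by norm_num)).const_mul 2).add
        ((hu.integrable_xDeriv_sq (t - d n) (k := 0) (by norm_num)).const_mul 2)).mono'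
        ((hc0.sub (hcx 0 (t - d n))).pow 2).aestronglyMeasurable
        (Filter.Eventually.of_forall fun x => ?_)
      rw [Real.norm_of_nonneg (sq_nonneg _)]
      show _ ≤ 2 * xDeriv u 0 t x ^ 2 + 2 * xDeriv u 0 (t - d n) x ^ 2
      nlinarith [sq_nonneg (xDeriv u 0 t x + xDeriv u 0 (t - d n) x)]
    refine integral_le_of_tendsto_of_forall_integral_le
      (F := fun n x => (d n ^ 2)⁻¹ * (xDeriv u 0 t x - xDeriv u 0 (t - d n) x) ^ 2)
      (fun n x => by positivity)
      (fun n => continuous_const.mul ((hc0.sub (hcx 0 (t - d n))).pow 2))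
      (fun n => (hi n).const_mul _) (fun n => ?_) (hwc.pow 2) fun x => ?_
    · rw [integral_const_mul, inv_mul_le_iff₀ (pow_pos (hd0 n) 2), mul_comm]
      exact hincr (d n) (hd0 n) (hd1 n)
    · have hslope := (hu.hasDerivAt_time_zero t x).tendsto_slope
      have htd : Filter.Tendsto (fun n => t - d n) Filter.atTop (nhdsWithin t {t}ᶜ) := by
        refine tendsto_nhdsWithin_iff.2 ⟨?_, Filter.Eventually.of_forall fun n => ?_⟩
        · simpa using hdlim.const_sub t
        · simp [(hd0 n).ne']
      have := (hslope.comp htd).pow 2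
      rw [neg_sq] at this
      refine this.congr fun n => ?_
      simp only [Function.comp_apply, slope_def_field]
      rw [sub_sub_cancel_left, div_pow, neg_sq, div_eq_inv_mul, sub_sq_comm]
  have h3 : ∫ x, xDeriv u 3 t x ^ 2 ≤ 2 * C + 18 * M ^ 4 * L := by
    have hwi : Integrable fun x => w x ^ 2 := by
      obtain ⟨D, -, hD⟩ := (sqDominatedOn_xDeriv u {t} (le_refl 3)).add (((BoundedOn.const 3).mul
        ((hu.boundedOn_xDeriv (I := {t}) (B := B) (k := 0) (by
          rintro _ rfl; exact hB _ htmem) (by norm_num)).pow 2)).mul_sqDominatedOn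
          (sqDominatedOn_xDeriv u {t} (k := 1) (by norm_num)))
      refine ((hu.integrable_sobolevDensity t).const_mul D).mono' (hwc.pow 2).aestronglyMeasurable
        (Filter.Eventually.of_forall fun x => ?_)
      rw [Real.norm_of_nonneg (sq_nonneg _)]
      exact hD t rfl x
    have hi1 := (hu.integrable_xDeriv_sq t (k := 1) (by norm_num)).const_mul (18 * M ^ 4)
    calc _ ≤ ∫ x, (2 * w x ^ 2 + 18 * M ^ 4 * xDeriv u 1 t x ^ 2) := by
          refine integral_mono_of_nonneg (Filter.Eventually.of_forall fun x => sq_nonneg _)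
            ((hwi.const_mul 2).add hi1) (Filter.Eventually.of_forall fun x => ?_)
          have h4 : xDeriv u 0 t x ^ 4 ≤ M ^ 4 := by
            rw [← Even.pow_abs (by decide)]
            exact pow_le_pow_left₀ (abs_nonneg _) (hMr 0 (by norm_num) t htmem x) 4
          have := mul_le_mul_of_nonneg_right h4 (sq_nonneg (xDeriv u 1 t x))
          have := sq_nonneg (w x + 3 * xDeriv u 0 t x ^ 2 * xDeriv u 1 t x)
          have e : xDeriv u 3 t x = w x - 3 * xDeriv u 0 t x ^ 2 * xDeriv u 1 t x := by
            rw [hw]; ring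
          show xDeriv u 3 t x ^ 2 ≤ _
          rw [e]
          linarith
      _ = _ := by rw [integral_add (hwi.const_mul 2) hi1, integral_const_mul, integral_const_mul]
      _ ≤ _ := add_le_add (by linarith) (mul_le_mul_of_nonneg_left
          (hLr t htmem 1 (by norm_num)) (by positivity))
  rw [hu.sobolevSq_eq]
  linarith [hLr t htmem 0 (by norm_num), hLr t htmem 1 (by norm_num), hLr t htmem 2 le_rfl]

theorem xDeriv_comp_neg (u : ℝ → ℝ → ℝ) (k : ℕ) (t x : ℝ) :
    xDeriv (fun t x => u (-t) (-x)) k t x = (-1) ^ k * xDeriv u k (-t) (-x) := by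
  simp only [xDeriv, iteratedDeriv_comp_neg, smul_eq_mul]

theorem comp_neg (hu : IsSolution u) : IsSolution fun t x => u (-t) (-x) where
  smooth := hu.smooth.comp (contDiff_fst.neg.prodMk contDiff_snd.neg)
  time t x := by
    simp only [xDeriv_comp_neg]
    have h := (hu.hasDerivAt_time_zero (-t) (-x)).comp t (hasDerivAt_neg t)
    simp only [pow_zero, one_mul]
    exact h.congr_deriv (by ring)
  decay t k hk := by
    obtain ⟨C, hC⟩ := hu.decay (-t) k hk
    refine ⟨C, fun x => ?_⟩
    have := hC (-x)
    rw [xDeriv_comp_neg, abs_mul, abs_pow, abs_neg, abs_one, one_pow, one_mul]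
    simpa using this

theorem sobolevSq_comp_neg (u : ℝ → ℝ → ℝ) (t : ℝ) :
    sobolevSq (fun t x => u (-t) (-x)) t = sobolevSq u (-t) := by
  unfold sobolevSq
  rw [← integral_neg_eq_self]
  congr with x
  simp only [sobolevDensity, xDeriv_comp_neg, mul_pow, neg_neg]
  norm_num

/-- The third order Sobolev norm is bounded in both time directions as long as it is finite. -/
theorem exists_sobolevSq_le (hu : IsSolution u) {K : ℝ} (hK : 0 ≤ K) :
    ∃ K', ∀ s t B : ℝ, |t - s| ≤ 1 → (∀ τ ∈ Set.uIcc s t, sobolevSq u τ ≤ B) →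
      sobolevSq u s ≤ K → sobolevSq u t ≤ K' := by
  obtain ⟨K₁, h₁⟩ := hu.exists_sobolevSq_le_of_le hK
  obtain ⟨K₂, h₂⟩ := hu.comp_neg.exists_sobolevSq_le_of_le hK
  refine ⟨max K₁ K₂, fun s t B hst hB hs => ?_⟩
  rw [abs_le] at hst
  rcases le_total s t with h | h
  · rw [Set.uIcc_of_le h] at hB
    exact (h₁ s t B h hst.2 hB hs).trans (le_max_left _ _)
  · rw [Set.uIcc_of_ge h] at hB
    have := h₂ (-s) (-t) B (by linarith) (by linarith) (fun τ hτ => by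
      rw [sobolevSq_comp_neg]
      exact hB _ ⟨by linarith [hτ.2], by linarith [hτ.1]⟩) (by
      rw [sobolevSq_comp_neg, neg_neg]
      exact hs)
    rw [sobolevSq_comp_neg, neg_neg] at this
    exact this.trans (le_max_right _ _)

end IsSolution

theorem exists_forall_mem_le_of_isCompact {N : ℝ → ℝ} {K : Set ℝ} (hK : IsCompact K)
    (hN : ∀ t ∈ K, ∃ B, ∀ᶠ τ in nhds t, N τ ≤ B) : ∃ B, ∀ t ∈ K, N t ≤ B := by
  refine hK.induction_on (p := fun S => ∃ B, ∀ t ∈ S, N t ≤ B) ⟨0, by simp⟩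
    (fun S T hST ⟨B, hB⟩ => ⟨B, fun t ht => hB t (hST ht)⟩)
    (fun S T ⟨B, hB⟩ ⟨D, hD⟩ => ⟨max B D, ?_⟩) (fun t ht => ?_)
  · rintro t (h | h)
    · exact (hB t h).trans (le_max_left _ _)
    · exact (hD t h).trans (le_max_right _ _)
  · obtain ⟨B, hB⟩ := hN t ht
    exact ⟨_, mem_nhdsWithin_of_mem_nhds hB, B, fun τ hτ => hτ⟩

/-- A function with closed sublevel sets which obeys an a priori estimate is locally bounded. -/
theorem exists_eventually_le_of_isClosed_sublevel {N : ℝ → ℝ}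
    (hN : ∀ K, IsClosed {t | N t ≤ K})
    (hP : ∀ K, ∃ K', ∀ s t B : ℝ, |t - s| ≤ 1 → (∀ τ ∈ Set.uIcc s t, N τ ≤ B) →
      N s ≤ K → N t ≤ K') (t : ℝ) : ∃ B, ∀ᶠ τ in nhds t, N τ ≤ B := by
  set G : Set ℝ := {t | ∃ B, ∀ᶠ τ in nhds t, N τ ≤ B} with hG
  have hGo : IsOpen G := by
    rw [isOpen_iff_mem_nhds]
    rintro t ⟨B, hB⟩
    filter_upwards [hB.eventually_nhds] with τ hτ using ⟨B, hτ⟩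
  have hS : IsClosed Gᶜ := hGo.isClosed_compl
  by_contra ht
  have hne : Nonempty (Gᶜ : Set ℝ) := ⟨⟨t, ht⟩⟩
  have hcomplete : CompleteSpace (Gᶜ : Set ℝ) := hS.completeSpace_coe
  obtain ⟨n, ⟨t₀, ht₀⟩, hn⟩ := nonempty_interior_of_iUnion_of_closed
    (f := fun n : ℕ => {τ : (Gᶜ : Set ℝ) | N τ ≤ n})
    (fun n => (hN n).preimage continuous_subtype_val)
    (Set.eq_univ_of_forall fun τ => Set.mem_iUnion.2 (exists_nat_ge (N τ)))
  obtain ⟨ε, hε, hball⟩ := Metric.mem_nhds_iff.1 (mem_interior_iff_mem_nhds.1 hn)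
  obtain ⟨K', hK'⟩ := hP n
  have hloc : ∀ τ ∈ Gᶜ, |τ - t₀| < ε → N τ ≤ n := fun τ hτ h =>
    hball (show (⟨τ, hτ⟩ : (Gᶜ : Set ℝ)) ∈ Metric.ball ⟨t₀, ht₀⟩ ε from h)
  refine ht₀ ⟨max n K', ?_⟩
  filter_upwards [Metric.ball_mem_nhds t₀ (lt_min hε one_pos)] with τ hτ
  rw [Metric.mem_ball, Real.dist_eq, lt_min_iff] at hτ
  by_cases hτG : τ ∈ G
  swap
  · exact (hloc τ hτG hτ.1).trans (le_max_left _ _)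
  refine le_trans ?_ (le_max_right _ _)
  obtain ⟨b, ⟨hbS, hb⟩, hmin⟩ := (isCompact_uIcc.inter_left hS).exists_isMinOn
    (s := Gᶜ ∩ Set.uIcc τ t₀) ⟨t₀, ht₀, Set.right_mem_uIcc⟩
    (f := fun y => |y - τ|) (by fun_prop)
  have hbτ : |b - τ| ≤ |τ - t₀| := by
    rw [abs_sub_comm τ t₀]
    exact Set.abs_sub_left_of_mem_uIcc hb
  have hbt : |b - t₀| ≤ |τ - t₀| := by
    rw [abs_sub_comm b t₀, abs_sub_comm τ t₀]
    exact Set.abs_sub_right_of_mem_uIcc hb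
  have hlt : ∀ y ∈ Set.uIcc τ b, y ≠ b → y ∈ G := by
    intro y hy hyb
    by_contra hyS
    have h1 : |b - τ| ≤ |y - τ| := hmin ⟨hyS, Set.uIcc_subset_uIcc_left hb hy⟩
    apply hyb
    rcases le_total τ b with h | h
    · rw [Set.uIcc_of_le h] at hy
      rw [abs_of_nonneg (sub_nonneg.2 h), abs_of_nonneg (sub_nonneg.2 hy.1)] at h1
      linarith [hy.2]
    · rw [Set.uIcc_of_ge h] at hy
      rw [abs_of_nonpos (sub_nonpos.2 h), abs_of_nonpos (sub_nonpos.2 hy.2)] at h1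
      linarith [hy.1]
  obtain ⟨D, hD⟩ := hP (N τ)
  have hbd : ∀ y ∈ Set.uIcc τ b, N y ≤ max D (N b) := by
    intro y hy
    rcases eq_or_ne y b with rfl | hyb
    · exact le_max_right _ _
    refine le_trans ?_ (le_max_left _ _)
    obtain ⟨B, hB⟩ := exists_forall_mem_le_of_isCompact (isCompact_uIcc (a := τ) (b := y))
      fun z hz => hlt z (Set.uIcc_subset_uIcc_left hy hz) fun hzb => by
        subst hzb
        apply hyb
        rcases le_total τ z with h | h
        · rw [Set.uIcc_of_le h] at hy
          rw [Set.uIcc_of_le hy.1] at hz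
          exact le_antisymm hy.2 hz.2
        · rw [Set.uIcc_of_ge h] at hy
          rw [Set.uIcc_of_ge hy.2] at hz
          exact le_antisymm hz.1 hy.1
    exact hD τ y B ((Set.abs_sub_left_of_mem_uIcc hy).trans (hbτ.trans hτ.2.le)) hB le_rfl
  rw [Set.uIcc_comm] at hbd
  exact hK' b τ _ (by rw [abs_sub_comm]; exact hbτ.trans hτ.2.le) hbd
    (hloc b hbS (hbt.trans_lt hτ.1))

namespace IsSolution

variable {u : ℝ → ℝ → ℝ}

theorem isClosed_sobolevSq_le (hu : IsSolution u) (K : ℝ) : IsClosed {t | sobolevSq u t ≤ K} := by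
  have h : {t | sobolevSq u t ≤ K} =
      ⋂ n : ℕ, {t | ∫ x in (-(n : ℝ))..n, sobolevDensity u t x ≤ K} := by
    ext t
    simp only [Set.mem_ofPred_eq, Set.mem_iInter]
    have hi := hu.integrable_sobolevDensity t
    refine ⟨fun h n => ?_, fun h => ?_⟩
    · rw [intervalIntegral.integral_of_le (by linarith [n.cast_nonneg (α := ℝ)])]
      exact (setIntegral_le_integral hi (Filter.Eventually.of_forall
        (sobolevDensity_nonneg u t))).trans h
    · exact le_of_tendsto' (intervalIntegral_tendsto_integral hi
        (Filter.tendsto_neg_atTop_atBot.comp tendsto_natCast_atTop_atTop)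
        tendsto_natCast_atTop_atTop) h
  rw [h]
  exact isClosed_iInter fun n => isClosed_le
    (intervalIntegral.continuous_parametric_intervalIntegral_of_continuous'
      (continuous_sobolevDensity hu.smooth) _ _) continuous_const

/-- The third order Sobolev norm of a solution is bounded on compact time intervals. -/
theorem exists_sobolevSq_le_of_mem_Icc (hu : IsSolution u) (a b : ℝ) :
    ∃ B, ∀ t ∈ Set.Icc a b, sobolevSq u t ≤ B := by
  refine exists_forall_mem_le_of_isCompact isCompact_Icc fun t _ =>
    exists_eventually_le_of_isClosed_sublevel hu.isClosed_sobolevSq_le (fun K => ?_) t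
  obtain ⟨K', hK'⟩ := hu.exists_sobolevSq_le (le_max_right K 0)
  exact ⟨K', fun s t B hst hB hs => hK' s t B hst hB (hs.trans (le_max_left _ _))⟩

end IsSolution

namespace IsSolution

variable {u : ℝ → ℝ → ℝ}

/-- Integrated form of the localized mass identity. -/
theorem integral_localized_mass_sub (hu : IsSolution u) {s t : ℝ} (hst : s ≤ t)
    {a a₁ a₂ a₃ : ℝ → ℝ} (ha : ∀ x, HasDerivAt a (a₁ x) x) (ha₁ : ∀ x, HasDerivAt a₁ (a₂ x) x)
    (ha₂ : ∀ x, HasDerivAt a₂ (a₃ x) x) (ha₃ : Continuous a₃)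
    (hb : ∃ C, ∀ x, |a x| ≤ C) (hb₁ : ∃ C, ∀ x, |a₁ x| ≤ C) (hb₂ : ∃ C, ∀ x, |a₂ x| ≤ C)
    (hb₃ : ∃ C, ∀ x, |a₃ x| ≤ C) :
    (∫ x, 1 / 2 * a x * (xDeriv u 0 t x * xDeriv u 0 t x))
        - ∫ x, 1 / 2 * a x * (xDeriv u 0 s x * xDeriv u 0 s x) =
      ∫ τ in s..t, ∫ x, (((-(3 / 2)) * a₁ x) * (xDeriv u 1 τ x * xDeriv u 1 τ x)
        + (3 / 4 * a₁ x) * xDeriv u 0 τ x ^ 2 * (xDeriv u 0 τ x * xDeriv u 0 τ x)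
        + 1 / 2 * a₃ x * (xDeriv u 0 τ x * xDeriv u 0 τ x)) := by
  obtain ⟨B, hB⟩ := hu.exists_sobolevSq_le_of_mem_Icc s t
  have hd := hasDerivAt_xDeriv hu.smooth
  have hc0 := continuous_xDeriv hu.smooth 0
  have hc1 := continuous_xDeriv hu.smooth 1
  have hc2 := continuous_xDeriv hu.smooth 2
  have hc3 := continuous_xDeriv hu.smooth 3
  have hac : Continuous a := continuous_iff_continuousAt.2 fun x => (ha x).continuousAt
  have hac₁ : Continuous a₁ := continuous_iff_continuousAt.2 fun x => (ha₁ x).continuousAt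
  have hac₂ : Continuous a₂ := continuous_iff_continuousAt.2 fun x => (ha₂ x).continuousAt
  have c0 : BoundedOn (Set.Icc s t) fun _ x => a x := hb.imp fun _ h _ _ x => h x
  have c1 : BoundedOn (Set.Icc s t) fun _ x => a₁ x := hb₁.imp fun _ h _ _ x => h x
  have c2 : BoundedOn (Set.Icc s t) fun _ x => a₂ x := hb₂.imp fun _ h _ _ x => h x
  have c3 : BoundedOn (Set.Icc s t) fun _ x => a₃ x := hb₃.imp fun _ h _ _ x => h x
  have b0 := hu.boundedOn_xDeriv hB (k := 0) (by norm_num)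
  have q0 := sqDominatedOn_xDeriv u (Set.Icc s t) (k := 0) (by norm_num)
  have q1 := sqDominatedOn_xDeriv u (Set.Icc s t) (k := 1) (by norm_num)
  have q2 := sqDominatedOn_xDeriv u (Set.Icc s t) (k := 2) (by norm_num)
  exact hu.integral_balance hst hB
    (e := fun τ x => 1 / 2 * a x * (xDeriv u 0 τ x * xDeriv u 0 τ x))
    (J := fun τ x => a x * (xDeriv u 0 τ x * xDeriv u 2 τ x
        + (-(1 / 2)) * (xDeriv u 1 τ x * xDeriv u 1 τ x)
        + (3 / 4 * xDeriv u 0 τ x ^ 2) * (xDeriv u 0 τ x * xDeriv u 0 τ x))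
      + ((-1) * a₁ x) * (xDeriv u 0 τ x * xDeriv u 1 τ x)
      + (1 / 2 * a₂ x) * (xDeriv u 0 τ x * xDeriv u 0 τ x))
    (J' := fun τ x => a x * (xDeriv u 0 τ x * xDeriv u 3 τ x
        + 3 * xDeriv u 0 τ x ^ 3 * xDeriv u 1 τ x)
      + a₁ x * ((-(3 / 2)) * xDeriv u 1 τ x ^ 2 + 3 / 4 * xDeriv u 0 τ x ^ 4)
      + 1 / 2 * a₃ x * xDeriv u 0 τ x ^ 2)
    (A := fun _ _ => 0) (A' := fun _ _ => 0) (A'' := fun _ _ => 0)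
    (g := fun τ x => ((-(3 / 2)) * a₁ x) * (xDeriv u 1 τ x * xDeriv u 1 τ x)
        + (3 / 4 * a₁ x) * xDeriv u 0 τ x ^ 2 * (xDeriv u 0 τ x * xDeriv u 0 τ x)
        + 1 / 2 * a₃ x * (xDeriv u 0 τ x * xDeriv u 0 τ x))
    (by fun_prop) (by fun_prop) (by fun_prop) (by fun_prop) (by fun_prop) (by fun_prop)
    (by fun_prop)
    (fun τ x => by
      have h0 := hd 0 τ x
      have h1 := hd 1 τ x
      have h2 := hd 2 τ x
      exact ((((ha x).fun_mul (((h0.fun_mul h2).fun_add ((h1.fun_mul h1).const_mul (-(1 / 2)))).fun_add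
        (((h0.fun_pow 2).const_mul (3 / 4)).fun_mul (h0.fun_mul h0)))).fun_add
        (((ha₁ x).const_mul (-1)).fun_mul (h0.fun_mul h1))).fun_add
        (((ha₂ x).const_mul (1 / 2)).fun_mul (h0.fun_mul h0))).congr_deriv (by push_cast; ring))
    (fun _ _ => hasDerivAt_const _ _) (fun _ _ => hasDerivAt_const _ _)
    (fun τ x => by
      have h0 := hu.hasDerivAt_time_zero τ x
      exact ((h0.fun_mul h0).const_mul (1 / 2 * a x)).congr_deriv (by ring))
    (((BoundedOn.const _).mul c0).mul_dominatedOn (q0.mul q0))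
    (((c0.mul_dominatedOn (((q0.mul q2).add ((BoundedOn.const _).mul_dominatedOn (q1.mul q1))).add
      (((BoundedOn.const _).mul (b0.pow 2)).mul_dominatedOn (q0.mul q0)))).add
      (((BoundedOn.const _).mul c1).mul_dominatedOn (q0.mul q1))).add
      (((BoundedOn.const _).mul c2).mul_dominatedOn (q0.mul q0)))
    DominatedOn.zero
    (((((BoundedOn.const _).mul c1).mul_dominatedOn (q1.mul q1)).add
      ((((BoundedOn.const _).mul c1).mul (b0.pow 2)).mul_dominatedOn (q0.mul q0))).add
      (((BoundedOn.const _).mul c3).mul_dominatedOn (q0.mul q0)))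

/-- The localized energy flux is locally Lipschitz in time. -/
theorem continuous_integral_localized_flux (hu : IsSolution u) {a a' c : ℝ → ℝ}
    (ha : ∀ x, HasDerivAt a (a' x) x) (ha' : Continuous a') (hc : Continuous c)
    (hb : ∃ C, ∀ x, |a x| ≤ C) (hb' : ∃ C, ∀ x, |a' x| ≤ C) (hbc : ∃ C, ∀ x, |c x| ≤ C) :
    Continuous fun τ => ∫ x, (((-(3 / 2)) * a x) * (xDeriv u 1 τ x * xDeriv u 1 τ x)
        + (3 / 4 * a x) * xDeriv u 0 τ x ^ 2 * (xDeriv u 0 τ x * xDeriv u 0 τ x)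
        + 1 / 2 * c x * (xDeriv u 0 τ x * xDeriv u 0 τ x)) := by
  set e : ℝ → ℝ → ℝ := fun τ x => ((-(3 / 2)) * a x) * (xDeriv u 1 τ x * xDeriv u 1 τ x)
        + (3 / 4 * a x) * xDeriv u 0 τ x ^ 2 * (xDeriv u 0 τ x * xDeriv u 0 τ x)
        + 1 / 2 * c x * (xDeriv u 0 τ x * xDeriv u 0 τ x) with he
  set g : ℝ → ℝ → ℝ := fun τ x => ((-3) * a' x) * (xDeriv u 1 τ x * xDeriv u 3 τ x)
      + ((-3) * a x) * (xDeriv u 2 τ x * xDeriv u 3 τ x)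
      + (18 * a x) * (xDeriv u 0 τ x * xDeriv u 1 τ x) * (xDeriv u 1 τ x * xDeriv u 1 τ x)
      + (9 * a x) * xDeriv u 0 τ x ^ 2 * (xDeriv u 1 τ x * xDeriv u 2 τ x)
      + ((-3) * a x * xDeriv u 0 τ x ^ 2 + (-1) * c x) * (xDeriv u 0 τ x * (xDeriv u 3 τ x
        + 3 * xDeriv u 0 τ x ^ 2 * xDeriv u 1 τ x)) with hg
  have hac : Continuous a := continuous_iff_continuousAt.2 fun x => (ha x).continuousAt
  have hd := hasDerivAt_xDeriv hu.smooth
  have hc0 := continuous_xDeriv hu.smooth 0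
  have hc1 := continuous_xDeriv hu.smooth 1
  have hc2 := continuous_xDeriv hu.smooth 2
  have hc3 := continuous_xDeriv hu.smooth 3
  have hc4 := continuous_xDeriv hu.smooth 4
  suffices hlip : ∀ s t : ℝ, ∃ L, ∀ σ ∈ Set.Icc s t, ∀ τ ∈ Set.Icc s t, σ ≤ τ →
      |(∫ x, e τ x) - ∫ x, e σ x| ≤ L * |τ - σ| by
    refine continuous_iff_continuousAt.2 fun t => ?_
    obtain ⟨L, hL⟩ := hlip (t - 1) (t + 1)
    have ht : t ∈ Set.Icc (t - 1) (t + 1) := ⟨by linarith, by linarith⟩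
    refine tendsto_iff_norm_sub_tendsto_zero.2 (squeeze_zero' (g := fun τ => L * |τ - t|)
      (Filter.Eventually.of_forall fun _ => norm_nonneg _) ?_ ?_)
    · filter_upwards [Icc_mem_nhds (by linarith : t - 1 < t) (by linarith : t < t + 1)] with τ hτ
      rcases le_total t τ with h | h
      · exact hL t ht τ hτ h
      · rw [norm_sub_rev, abs_sub_comm]
        exact hL τ hτ t ht h
    · have : Continuous fun τ => L * |τ - t| := by fun_prop
      simpa using this.tendsto t
  intro s t
  obtain ⟨B, hB⟩ := hu.exists_sobolevSq_le_of_mem_Icc s t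
  have c0 : BoundedOn (Set.Icc s t) fun _ x => a x := hb.imp fun _ h _ _ x => h x
  have c1 : BoundedOn (Set.Icc s t) fun _ x => a' x := hb'.imp fun _ h _ _ x => h x
  have c2 : BoundedOn (Set.Icc s t) fun _ x => c x := hbc.imp fun _ h _ _ x => h x
  have b0 := hu.boundedOn_xDeriv hB (k := 0) (by norm_num)
  have b1 := hu.boundedOn_xDeriv hB (k := 1) (by norm_num)
  have q0 := sqDominatedOn_xDeriv u (Set.Icc s t) (k := 0) (by norm_num)
  have q1 := sqDominatedOn_xDeriv u (Set.Icc s t) (k := 1) (by norm_num)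
  have q2 := sqDominatedOn_xDeriv u (Set.Icc s t) (k := 2) (by norm_num)
  have q3 := sqDominatedOn_xDeriv u (Set.Icc s t) (k := 3) (by norm_num)
  have k := fun r : ℝ => BoundedOn.const (I := Set.Icc s t) r
  have hgρ : DominatedOn (Set.Icc s t) (sobolevDensity u) g :=
    (((((k (-3)).mul c1).mul_dominatedOn (q1.mul q3)).add
      (((k (-3)).mul c0).mul_dominatedOn (q2.mul q3))).add
      ((((k 18).mul c0).mul (b0.mul b1)).mul_dominatedOn (q1.mul q1))).add
      ((((k 9).mul c0).mul (b0.pow 2)).mul_dominatedOn (q1.mul q2)) |>.add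
      (((((k (-3)).mul c0).mul (b0.pow 2)).add ((k (-1)).mul c2)).mul_dominatedOn
        (q0.mul (q3.add (((k 3).mul (b0.pow 2)).mul_sqDominatedOn q1))))
  have heρ : DominatedOn (Set.Icc s t) (sobolevDensity u) e :=
    ((((k _).mul c0).mul_dominatedOn (q1.mul q1)).add
      ((((k _).mul c0).mul (b0.pow 2)).mul_dominatedOn (q0.mul q0))).add
      (((k _).mul c2).mul_dominatedOn (q0.mul q0))
  have hJρ : DominatedOn (Set.Icc s t) (sobolevDensity u)
      (fun τ x => (-3) * a x * (xDeriv u 1 τ x * xDeriv u 3 τ x)) :=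
    ((k _).mul c0).mul_dominatedOn (q1.mul q3)
  obtain ⟨C, hC, hgC⟩ := hgρ
  refine ⟨C * B, fun σ hσ τ hτ hστ => ?_⟩
  have hsub : Set.Icc σ τ ⊆ Set.Icc s t := Set.Icc_subset_Icc hσ.1 hτ.2
  rw [hu.integral_balance hστ (fun r hr => hB r (hsub hr)) (e := e)
    (J := fun τ x => (-3) * a x * (xDeriv u 1 τ x * xDeriv u 3 τ x))
    (J' := fun τ x => (-3) * a' x * (xDeriv u 1 τ x * xDeriv u 3 τ x)
      + (-3) * a x * (xDeriv u 2 τ x * xDeriv u 3 τ x + xDeriv u 1 τ x * xDeriv u 4 τ x))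
    (A := fun _ _ => 0) (A' := fun _ _ => 0) (A'' := fun _ _ => 0) (g := g)
    (by fun_prop) (by fun_prop) (by fun_prop) (by fun_prop) (by fun_prop) (by fun_prop)
    (by fun_prop)
    (fun τ x => (((ha x).const_mul (-3)).fun_mul ((hd 1 τ x).fun_mul (hd 3 τ x))).congr_deriv
      (by ring))
    (fun _ _ => hasDerivAt_const _ _) (fun _ _ => hasDerivAt_const _ _)
    (fun τ x => by
      have h0 := hu.hasDerivAt_time_zero τ x
      have h1 := hu.hasDerivAt_time_one τ x
      exact ((((h1.fun_mul h1).const_mul ((-(3 / 2)) * a x)).fun_add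
        (((h0.fun_pow 2).const_mul (3 / 4 * a x)).fun_mul (h0.fun_mul h0))).fun_add
        ((h0.fun_mul h0).const_mul (1 / 2 * c x))).congr_deriv (by rw [hg]; push_cast; ring))
    (heρ.mono hsub) (hJρ.mono hsub) DominatedOn.zero
    ⟨C, hC, fun r hr => hgC r (hsub hr)⟩]
  suffices hle : ∀ r ∈ Set.uIoc σ τ, ‖∫ x, g r x‖ ≤ C * B from
    intervalIntegral.norm_integral_le_of_norm_le_const hle
  intro r hr
  rw [Set.uIoc_of_le hστ] at hr
  have hr' : r ∈ Set.Icc s t := hsub ⟨hr.1.le, hr.2⟩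
  calc ‖∫ x, g r x‖ ≤ ∫ x, C * sobolevDensity u r x :=
        norm_integral_le_of_norm_le ((hu.integrable_sobolevDensity r).const_mul C)
          (Filter.Eventually.of_forall (hgC r hr'))
    _ = C * sobolevSq u r := integral_const_mul _ _
    _ ≤ C * B := mul_le_mul_of_nonneg_left (hB r hr') hC

/-- Differential form of the localized mass identity. -/
theorem hasDerivAt_localized_mass (hu : IsSolution u) (t : ℝ)
    {a a₁ a₂ a₃ : ℝ → ℝ} (ha : ∀ x, HasDerivAt a (a₁ x) x) (ha₁ : ∀ x, HasDerivAt a₁ (a₂ x) x)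
    (ha₂ : ∀ x, HasDerivAt a₂ (a₃ x) x) (ha₃ : Continuous a₃)
    (hb : ∃ C, ∀ x, |a x| ≤ C) (hb₁ : ∃ C, ∀ x, |a₁ x| ≤ C) (hb₂ : ∃ C, ∀ x, |a₂ x| ≤ C)
    (hb₃ : ∃ C, ∀ x, |a₃ x| ≤ C) :
    HasDerivAt (fun s => ∫ x, 1 / 2 * a x * (xDeriv u 0 s x * xDeriv u 0 s x))
      (∫ x, (((-(3 / 2)) * a₁ x) * (xDeriv u 1 t x * xDeriv u 1 t x)
        + (3 / 4 * a₁ x) * xDeriv u 0 t x ^ 2 * (xDeriv u 0 t x * xDeriv u 0 t x)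
        + 1 / 2 * a₃ x * (xDeriv u 0 t x * xDeriv u 0 t x))) t := by
  have hac₂ : Continuous a₂ := continuous_iff_continuousAt.2 fun x => (ha₂ x).continuousAt
  have hF := hu.continuous_integral_localized_flux ha₁ hac₂ ha₃ hb₁ hb₂ hb₃
  have hD := (hF.integral_hasStrictDerivAt (t - 1) t).hasDerivAt.const_add
    (∫ x, 1 / 2 * a x * (xDeriv u 0 (t - 1) x * xDeriv u 0 (t - 1) x))
  refine hD.congr_of_eventuallyEq ?_
  filter_upwards [Ioi_mem_nhds (by linarith : t - 1 < t)] with τ hτ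
  rw [← hu.integral_localized_mass_sub (le_of_lt hτ) ha ha₁ ha₂ ha₃ hb hb₁ hb₂ hb₃]
  ring

end IsSolution

theorem isSolution_of_deriv_eq {u : ℝ → ℝ → ℝ} (hu : ContDiff ℝ (⊤ : ℕ∞) (Function.uncurry u))
    (hmkdv : ∀ t x : ℝ,
      deriv (fun s => u s x) t
        + deriv (fun y => deriv (deriv (u t)) y + (u t y) ^ 3) x = 0)
    (hdecay : ∀ t : ℝ, ∀ k : ℕ, k ≤ 3 → ∀ n : ℕ,
      ∃ C : ℝ, ∀ x : ℝ, |x| ^ n * |iteratedDeriv k (u t) x| ≤ C) : IsSolution u where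
  smooth := hu
  time t x := by
    have h0 : xDeriv u 0 = u := by ext; simp [xDeriv]
    have h2 : ∀ y, deriv (deriv (u t)) y = xDeriv u 2 t y := fun y => by
      simp only [xDeriv, iteratedDeriv_succ, iteratedDeriv_zero]
    have hd := hasDerivAt_xDeriv hu
    have h3 : HasDerivAt (fun y => xDeriv u 2 t y + xDeriv u 0 t y ^ 3)
        (xDeriv u 3 t x + 3 * xDeriv u 0 t x ^ 2 * xDeriv u 1 t x) x :=
      ((hd 2 t x).fun_add ((hd 0 t x).fun_pow 3)).congr_deriv (by push_cast; ring)
    have ht := hasDerivAt_fderiv_left (hu.differentiable (by simp)) t x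
    have hm := hmkdv t x
    simp only [h2] at hm
    rw [h0] at h3 ⊢
    rw [h3.deriv] at hm
    rw [zero_sub, ← eq_neg_of_add_eq_zero_left hm, ht.deriv]
    exact ht
  decay t k hk := by
    obtain ⟨C, hC⟩ := hdecay t k hk 0
    obtain ⟨D, hD⟩ := hdecay t k hk 2
    refine ⟨C + D, fun x => ?_⟩
    have h1 := hC x
    have h2 := hD x
    rw [pow_zero, one_mul] at h1
    rw [sq_abs] at h2
    rw [add_mul, one_mul]
    exact add_le_add h1 h2

/-- Time derivative of the localized mass: if `f` is `C³` and bounded together with its first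
three derivatives, and `u` is a smooth classical solution of mKdV
(`u_t + (u_xx + u³)_x = 0`) which is Schwartz in `x` (together with its `x`-derivatives up to
order three) at each time, then
`(d/dt) (1/2) ∫ u² f = ∫ (-(3/2) u_x² + (3/4) u⁴) f' + (1/2) ∫ u² f'''`. -/
theorem localized_mass_time_derivative
    (f : ℝ → ℝ) (hf : ContDiff ℝ 3 f)
    (hfbdd : ∀ k : ℕ, k ≤ 3 → ∃ C : ℝ, ∀ x : ℝ, |iteratedDeriv k f x| ≤ C)
    (u : ℝ → ℝ → ℝ) (hu : ContDiff ℝ (⊤ : ℕ∞) (Function.uncurry u))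
    (hmkdv : ∀ t x : ℝ,
      deriv (fun s => u s x) t
        + deriv (fun y => deriv (deriv (u t)) y + (u t y) ^ 3) x = 0)
    (hdecay : ∀ t : ℝ, ∀ k : ℕ, k ≤ 3 → ∀ n : ℕ,
      ∃ C : ℝ, ∀ x : ℝ, |x| ^ n * |iteratedDeriv k (u t) x| ≤ C) :
    ∀ t : ℝ,
      HasDerivAt (fun s => (1 / 2) * ∫ x : ℝ, (u s x) ^ 2 * f x)
        ((∫ x : ℝ, (-(3 / 2) * (deriv (u t) x) ^ 2 + (3 / 4) * (u t x) ^ 4) * deriv f x)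
          + (1 / 2) * ∫ x : ℝ, (u t x) ^ 2 * iteratedDeriv 3 f x) t := by
  intro t
  have hsol := isSolution_of_deriv_eq hu hmkdv hdecay
  have hD : ∀ k, k < 3 → ∀ x, HasDerivAt (iteratedDeriv k f) (iteratedDeriv (k + 1) f x) x := by
    intro k hk x
    rw [iteratedDeriv_succ]
    exact (hf.differentiable_iteratedDeriv k (by exact_mod_cast hk) x).hasDerivAt
  have hu0 : ∀ s x, xDeriv u 0 s x = u s x := fun s x => by simp [xDeriv]
  have hu1 : ∀ s x, xDeriv u 1 s x = deriv (u s) x := fun s x => by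
    simp [xDeriv, iteratedDeriv_one]
  have key := hsol.hasDerivAt_localized_mass t (hD 0 (by norm_num)) (hD 1 (by norm_num))
    (hD 2 (by norm_num)) (hf.continuous_iteratedDeriv 3 le_rfl) (hfbdd 0 (by norm_num))
    (hfbdd 1 (by norm_num)) (hfbdd 2 (by norm_num)) (hfbdd 3 le_rfl)
  have hi : ∀ {p : ℝ → ℝ} {P : ℝ} {k : ℕ}, Continuous p → (∀ x, |p x| ≤ P) → k ≤ 3 →
      Integrable fun x => p x * xDeriv u k t x ^ 2 := fun hp hP hk =>
    (hsol.integrable_xDeriv_sq t hk).bdd_mul hp.aestronglyMeasurable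
      (Filter.Eventually.of_forall hP)
  have hf1c : Continuous (iteratedDeriv 1 f) := hf.continuous_iteratedDeriv 1 (by norm_num)
  obtain ⟨C₁, hC₁⟩ := hfbdd 1 (by norm_num)
  obtain ⟨C₃, hC₃⟩ := hfbdd 3 le_rfl
  obtain ⟨M, hM⟩ := hsol.boundedOn_xDeriv (I := {t}) (B := sobolevSq u t) (k := 0)
    (by rintro _ rfl; exact le_rfl) (by norm_num)
  have hMt := hM t rfl
  have hc0 : Continuous fun x => xDeriv u 0 t x :=
    (continuous_xDeriv hu 0).comp (by fun_prop : Continuous fun x : ℝ => (t, x))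
  have i1 := (hi hf1c hC₁ (k := 1) (by norm_num)).const_mul (-(3 / 2))
  have i2 := (hi (p := fun x => iteratedDeriv 1 f x * xDeriv u 0 t x ^ 2) (P := C₁ * M ^ 2) (k := 0)
    (by fun_prop) (fun x => by
      rw [abs_mul, abs_pow]
      exact mul_le_mul (hC₁ x) (pow_le_pow_left₀ (abs_nonneg _) (hMt x) 2) (by positivity)
        ((abs_nonneg _).trans (hC₁ x))) (by norm_num)).const_mul (3 / 4)
  have i12 : Integrable fun x =>
      (-(3 / 2) * deriv (u t) x ^ 2 + 3 / 4 * u t x ^ 4) * deriv f x := by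
    refine (i1.add i2).congr (Filter.Eventually.of_forall fun x => ?_)
    simp only [Pi.add_apply, hu0, hu1, iteratedDeriv_one]
    ring
  have i3 : Integrable fun x => 1 / 2 * (u t x ^ 2 * iteratedDeriv 3 f x) := by
    refine ((hi (hf.continuous_iteratedDeriv 3 le_rfl) hC₃ (k := 0) (by norm_num)).const_mul
      (1 / 2)).congr (Filter.Eventually.of_forall fun x => ?_)
    simp only [hu0]
    ring
  convert key using 1
  · funext s
    rw [← integral_const_mul]
    congr with x
    rw [hu0, iteratedDeriv_zero]
    ring
  · rw [← integral_const_mul, ← integral_add i12 i3]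
    congr with x
    rw [hu0, hu1, iteratedDeriv_one]
    ring
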